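/- arXiv:2102.12275 — 2 statements merged into one kernel-verified Lean document; each statement's English description precedes it below -/
import Mathlib

section
/- Let n ≥ 2 and let K ⊂ ℝⁿ be a compact convex body with nonempty interior whose boundary ∂K is a C^∞ semi-algebraic hypersurface: there is a real polynomial Q in n variables, irreducible over ℂ, with ∂K ⊆ Q⁻¹(0) and ∇Q(x) ≠ 0 for all x ∈ ∂K. Fix m ∈ ℕ, m ≥ 1. Suppose that for every affine line L with L ∩ int K ≠ ∅ and every unit vector ξ ∈ ℝⁿ there exists a polynomial P_{L,ξ} of one real variable such that μ_{L,ξ}(t)^m = P_{L,ξ}(t) for all t in some neighborhood of 0, where μ_{L,ξ}(t) is the length of the chord K ∩ (L + t·ξ). Then ∂K is an ellipsoid, i.e., K is the image of the closed Euclidean unit ball under an invertible affine map of ℝⁿ. -/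
open MeasureTheory

/-- The chord length function: length of `K ∩ (L + t·ξ)` where `L = {p + s·v}`. -/
noncomputable def chordLenLine {n : ℕ} (K : Set (EuclideanSpace ℝ (Fin n)))
    (p v ξ : EuclideanSpace ℝ (Fin n)) (t : ℝ) : ℝ :=
  (volume {s : ℝ | p + s • v + t • ξ ∈ K}).toReal

open Set Filter Topology Polynomial

/-- A function that is polynomial near every point of an open interval is polynomial on it. -/
theorem exists_polynomial_of_locally_polynomial {f : ℝ → ℝ} {a b : ℝ}
    (h : ∀ t₀ ∈ Ioo a b, ∃ P : ℝ[X], ∀ᶠ t in 𝓝 t₀, f t = P.eval t) :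
    ∃ P : ℝ[X], ∀ t ∈ Ioo a b, f t = P.eval t := by
  rcases (Ioo a b).eq_empty_or_nonempty with he | ⟨t₀, ht₀⟩
  · exact ⟨0, by simp [he]⟩
  choose! F hF using h
  refine ⟨F t₀, fun t ht => ?_⟩
  have key : F t = F t₀ := by
    refine isPreconnected_Ioo.induction₂' (fun x y => F x = F y) (fun x hx => ?_)
      (fun x y z _ _ _ h₁ h₂ => h₁.trans h₂) ht ht₀
    have h₁ : ∀ᶠ y in 𝓝[Ioo a b] x, ∀ᶠ t in 𝓝 y, f t = (F x).eval t :=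
      nhdsWithin_le_nhds (eventually_eventually_nhds.2 (hF x hx))
    filter_upwards [h₁, self_mem_nhdsWithin] with y hy hyI
    have : F x = F y := by
      refine Polynomial.eq_of_infinite_eval_eq _ _ ?_
      have h₂ : ∀ᶠ t in 𝓝 y, (F x).eval t = (F y).eval t := by
        filter_upwards [hy, hF y hyI] with t h₁ h₂
        rw [← h₁, h₂]
      exact infinite_of_mem_nhds y h₂
    exact ⟨this, this.symm⟩
  rw [← key]
  exact (hF t ht).self_of_nhds

theorem eval₂_pi_evalRingHom_apply {S : Set ℝ} (p : ℝ[X][X]) (g : S → ℝ) (s : S) :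
    p.eval₂ (RingHom.pi fun s : S => evalRingHom (s : ℝ)) g s =
      p.eval₂ (evalRingHom (s : ℝ)) (g s) :=
  Polynomial.hom_eval₂ p (RingHom.pi fun s : S => evalRingHom (s : ℝ))
    (Pi.evalRingHom (fun _ : S => ℝ) s) g

/-- A quotient `r / s ^ e` with `r(0) ≠ 0` that is integral over `ℝ[s]` has `e = 0`. -/
theorem eq_zero_of_isIntegralElem_div {S : Set ℝ} (hS : S.Infinite) {g : S → ℝ}
    (hg : (RingHom.pi fun s : S => evalRingHom (s : ℝ)).IsIntegralElem g) {r : ℝ[X]} {e : ℕ}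
    (hr : r.eval 0 ≠ 0) (h : ∀ s : S, (s : ℝ) ^ e * g s = r.eval (s : ℝ)) : e = 0 := by
  obtain ⟨p, hp, hpg⟩ := hg
  by_contra he
  have h₁ : (p.scaleRoots (X ^ e)).eval r = 0 := by
    refine Polynomial.eq_zero_of_infinite_isRoot _ (hS.mono fun s hs => ?_)
    have h₃ : p.eval₂ (evalRingHom s) (g ⟨s, hs⟩) = 0 := by
      rw [← eval₂_pi_evalRingHom_apply p g ⟨s, hs⟩, hpg, Pi.zero_apply]
    have h₄ := Polynomial.scaleRoots_eval₂_eq_zero (evalRingHom s) (s := X ^ e) h₃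
    have h₅ : (evalRingHom s) (X ^ e) * g ⟨s, hs⟩ = (evalRingHom s) r := by
      simpa using h ⟨s, hs⟩
    rw [h₅, Polynomial.eval₂_at_apply] at h₄
    simpa using h₄
  have h₆ : (p.scaleRoots (X ^ e)).eval₂ (evalRingHom (0 : ℝ)) (r.eval 0) = 0 := by
    have := Polynomial.eval₂_at_apply (p := p.scaleRoots (X ^ e)) (evalRingHom (0 : ℝ)) r
    rw [h₁] at this
    simpa using this
  have h₇ : (p.scaleRoots (X ^ e)).map (evalRingHom (0 : ℝ)) = X ^ p.natDegree := by
    ext i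
    rw [coeff_map, coeff_scaleRoots, coeff_X_pow]
    split_ifs with hi
    · subst hi; simp [hp]
    · rcases lt_or_gt_of_ne hi with hi | hi
      · have : e * (p.natDegree - i) ≠ 0 := by
          refine mul_ne_zero he ?_
          omega
        simp [← pow_mul, this]
      · simp [coeff_eq_zero_of_natDegree_lt hi]
  rw [eval₂_eq_eval_map, h₇, eval_pow, eval_X] at h₆
  exact hr (eq_zero_of_pow_eq_zero h₆)

/-- For all but finitely many slopes `k`, the points of the curve `R = 0` on the lines
`x = t + k y` have ordinates whose ratio to `t` is integral over `ℝ[1 / t]`. -/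
theorem exists_polynomial_isIntegralElem {R : MvPolynomial (Fin 2) ℝ} (hR : R ≠ 0) :
    ∃ L : ℝ[X], L ≠ 0 ∧ ∀ k, L.eval k ≠ 0 → ∀ (S : Set ℝ), 0 ∉ S → ∀ y : ℝ → ℝ,
      (∀ s ∈ S, MvPolynomial.eval ![s⁻¹ + k * y s⁻¹, y s⁻¹] R = 0) →
      (RingHom.pi fun s : S => evalRingHom (s : ℝ)).IsIntegralElem
        (fun s : S => s * y (s : ℝ)⁻¹) := by
  classical
  have hdeg : ∀ d ∈ R.support, d 0 + d 1 ≤ R.totalDegree := fun d hd => by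
    have := MvPolynomial.le_totalDegree hd
    simpa [Finsupp.sum_fintype] using this
  set N := R.totalDegree with hN
  obtain ⟨d₀, hd₀, hd₀N⟩ : ∃ d ∈ R.support, d 0 + d 1 = N := by
    have := Finset.exists_mem_eq_sup R.support (MvPolynomial.support_nonempty.2 hR)
      (fun s => s.sum fun _ e => e)
    obtain ⟨d, hd, h⟩ := this
    refine ⟨d, hd, ?_⟩
    rw [hN, MvPolynomial.totalDegree, h]
    simp [Finsupp.sum_fintype]
  refine ⟨∑ d ∈ R.support, if d 0 + d 1 = N then C (R.coeff d) * X ^ d 0 else 0, ?_, ?_⟩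
  · intro h
    have h₁ := congrArg (fun p => p.coeff (d₀ 0)) h
    simp only [finsetSum_coeff, coeff_zero] at h₁
    rw [Finset.sum_eq_single_of_mem d₀ hd₀] at h₁
    · rw [if_pos hd₀N] at h₁
      simp at h₁
      exact MvPolynomial.mem_support_iff.1 hd₀ h₁
    · intro d hd hne
      split_ifs with h₂
      · rw [coeff_C_mul, coeff_X_pow, if_neg, mul_zero]
        intro h₃
        apply hne
        ext i
        fin_cases i
        · exact h₃.symm
        · change d 1 = d₀ 1
          omega
      · simp
  · intro k hk S hS y hy
    set l : ℝ := eval k (∑ d ∈ R.support, if d 0 + d 1 = N then C (R.coeff d) * X ^ d 0 else 0)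
    set T : ℝ[X][X] := ∑ d ∈ R.support, C (C (R.coeff d) * X ^ (N - (d 0 + d 1))) *
      ((1 + C (C k) * X) ^ d 0 * X ^ d 1) with hT
    have hlin : (1 + C (C k) * X : ℝ[X][X]).natDegree ≤ 1 := by
      compute_degree
    have hmon : ∀ d : Fin 2 →₀ ℕ, ((1 + C (C k) * X : ℝ[X][X]) ^ d 0 * X ^ d 1).natDegree
        ≤ d 0 + d 1 := fun d => by
      refine natDegree_mul_le.trans ?_
      gcongr
      · exact (natDegree_pow_le_of_le _ hlin).trans (by simp)
      · simp
    have hTdeg : T.natDegree ≤ N := by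
      refine natDegree_sum_le_of_forall_le _ _ fun d hd => ?_
      exact (natDegree_C_mul_le _ _).trans ((hmon d).trans (hdeg d hd))
    have hTcoeff : T.coeff N = C l := by
      simp only [hT, finsetSum_coeff, l, eval_finsetSum, map_sum]
      refine Finset.sum_congr rfl fun d hd => ?_
      rw [coeff_C_mul]
      split_ifs with h
      · have h₁ : ((1 + C (C k) * X : ℝ[X][X]) ^ d 0 * X ^ d 1).coeff N = C k ^ d 0 := by
          have h₂ := coeff_pow_of_natDegree_le hlin (m := d 0)
          rw [← h, coeff_mul_X_pow]
          rw [mul_one] at h₂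
          rw [h₂]
          simp [coeff_one]
        rw [h₁, h]
        simp
      · have h₁ : ((1 + C (C k) * X : ℝ[X][X]) ^ d 0 * X ^ d 1).coeff N = 0 :=
          coeff_eq_zero_of_natDegree_lt ((hmon d).trans_lt (lt_of_le_of_ne (hdeg d hd) h))
        simp [h₁]
    refine ⟨C (C l⁻¹) * T, ?_, ?_⟩
    · refine monic_of_natDegree_le_of_coeff_eq_one N ((natDegree_C_mul_le _ _).trans hTdeg) ?_
      rw [coeff_C_mul, hTcoeff, ← C_mul, inv_mul_cancel₀ hk, C_1]
    · rw [eval₂_mul]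
      convert mul_zero _
      ext ⟨s, hs⟩
      have hs0 : s ≠ 0 := fun h => hS (h ▸ hs)
      rw [eval₂_pi_evalRingHom_apply, Pi.zero_apply]
      have h₂ := hy s hs
      rw [MvPolynomial.eval_eq'] at h₂
      have h₃ := congrArg (fun z => s ^ N * z) h₂
      simp only [mul_zero, Finset.mul_sum] at h₃
      rw [hT, eval₂_finsetSum, ← h₃]
      refine Finset.sum_congr rfl fun d hd => ?_
      obtain ⟨e, he⟩ := Nat.exists_eq_add_of_le (hdeg d hd)
      simp [eval₂_mul, eval₂_pow]
      rw [he, Nat.add_sub_cancel_left, pow_add, pow_add]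
      have h₄ : s⁻¹ + k * y s⁻¹ = s⁻¹ * (1 + k * (s * y s⁻¹)) := by
        field_simp
      rw [h₄, mul_pow, mul_pow, inv_pow]
      field_simp

/-- The degree of a polynomial equal to the `m`-th power of a difference of two ordinates of an
algebraic curve along the lines `x = t + k y` is at most `m`, for all but finitely many `k`. -/
theorem exists_polynomial_natDegree_le {R : MvPolynomial (Fin 2) ℝ} (hR : R ≠ 0) :
    ∃ L : ℝ[X], L ≠ 0 ∧ ∀ k, L.eval k ≠ 0 → ∀ (a b : ℝ), a < b → ∀ (y₁ y₂ : ℝ → ℝ) (P : ℝ[X])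
      (m : ℕ),
      (∀ t ∈ Ioo a b, MvPolynomial.eval ![t + k * y₁ t, y₁ t] R = 0) →
      (∀ t ∈ Ioo a b, MvPolynomial.eval ![t + k * y₂ t, y₂ t] R = 0) →
      (∀ t ∈ Ioo a b, (y₂ t - y₁ t) ^ m = P.eval t) → P.natDegree ≤ m := by
  obtain ⟨L, hL, h⟩ := exists_polynomial_isIntegralElem hR
  refine ⟨L, hL, fun k hk a b hab y₁ y₂ P m h₁ h₂ hP => ?_⟩
  by_contra! hm
  set S : Set ℝ := Inv.inv '' (Ioo a b \ {0}) with hSdef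
  have hS0 : (0 : ℝ) ∉ S := by
    rintro ⟨t, ht, h0⟩
    exact ht.2 (inv_eq_zero.1 h0)
  have hSinf : S.Infinite :=
    ((Ioo_infinite hab).sdiff (finite_singleton 0)).image inv_injective.injOn
  have hmem : ∀ s ∈ S, s⁻¹ ∈ Ioo a b := by
    rintro _ ⟨t, ht, rfl⟩
    simpa using ht.1
  have i₁ := h k hk S hS0 y₁ fun s hs => h₁ _ (hmem s hs)
  have i₂ := h k hk S hS0 y₂ fun s hs => h₂ _ (hmem s hs)
  have i₃ : (RingHom.pi fun s : S => evalRingHom (s : ℝ)).IsIntegralElem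
      ((fun s : S => (s : ℝ) * y₂ (s : ℝ)⁻¹) - fun s : S => s * y₁ (s : ℝ)⁻¹) :=
    RingHom.IsIntegralElem.sub _ i₂ i₁
  have i₄ : (RingHom.pi fun s : S => evalRingHom (s : ℝ)).IsIntegralElem
      (((fun s : S => (s : ℝ) * y₂ (s : ℝ)⁻¹) - fun s : S => s * y₁ (s : ℝ)⁻¹) ^ m) := by
    let _ := (RingHom.pi fun s : S => evalRingHom (s : ℝ)).toAlgebra
    exact IsIntegral.pow (R := ℝ[X]) i₃ m
  have hP0 : P ≠ 0 := by
    rintro rfl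
    simp at hm
  have := eq_zero_of_isIntegralElem_div hSinf i₄ (r := P.reverse) (e := P.natDegree - m)
    (by rw [← coeff_zero_eq_eval_zero, coeff_zero_reverse]; simpa using hP0) (fun s => by
      have hs0 : (s : ℝ) ≠ 0 := fun h => hS0 (h ▸ s.2)
      have h₃ := hP _ (hmem s s.2)
      simp only [Pi.pow_apply, Pi.sub_apply]
      rw [← mul_sub, mul_pow, h₃, ← mul_assoc, ← pow_add, Nat.sub_add_cancel hm.le]
      let _ := invertibleOfNonzero (inv_ne_zero hs0)
      have h₄ := eval₂_reverse_mul_pow (RingHom.id ℝ) (s : ℝ)⁻¹ P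
      simp only [invOf_eq_inv, inv_inv] at h₄
      rw [← eval₂_id (p := P), ← h₄, eval₂_id, inv_pow]
      field_simp)
  omega

/-- For almost every slope `k`, the functional `x - k y` grows at least quadratically in `y` away
from its minimum on a compact planar set. -/
theorem ae_exists_quadratic_growth {C : Set (ℝ × ℝ)} (hC : IsCompact C) (hne : C.Nonempty) :
    ∀ᵐ k : ℝ, ∃ z ∈ C, ∃ A : ℝ, 0 < A ∧ ∀ p ∈ C,
      (p.2 - z.2) ^ 2 ≤ A * ((p.1 - k * p.2) - (z.1 - k * z.2)) := by
  have hmin : ∀ k : ℝ, ∃ z ∈ C, ∀ p ∈ C, z.1 - k * z.2 ≤ p.1 - k * p.2 := fun k =>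
    hC.exists_isMinOn hne (f := fun p : ℝ × ℝ => p.1 - k * p.2) (by fun_prop)
  choose z hzC hz using hmin
  have hmono : Monotone fun k => (z k).2 := by
    intro k k' hk
    rcases hk.eq_or_lt with rfl | hk
    · rfl
    have h₁ := hz k _ (hzC k')
    have h₂ := hz k' _ (hzC k)
    have h₃ : 0 ≤ (k' - k) * ((z k').2 - (z k).2) := by linarith
    exact sub_nonneg.1 (nonneg_of_mul_nonneg_right h₃ (sub_pos.2 hk))
  obtain ⟨B, hB⟩ : ∃ B, ∀ p ∈ C, ‖p‖ ≤ B := hC.isBounded.exists_norm_le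
  filter_upwards [hmono.ae_differentiableAt] with k hk
  obtain ⟨c, hc, hc'⟩ := hk.hasDerivAt.isBigO_sub.exists_pos
  obtain ⟨δ, hδ, hδc⟩ := Metric.eventually_nhds_iff.1 hc'.bound
  have hB0 : 0 ≤ B := (norm_nonneg _).trans (hB _ (hzC k))
  refine ⟨z k, hzC k, 4 * (c + (B + 1) / δ), by positivity, fun p hp => ?_⟩
  set A := c + (B + 1) / δ with hA
  have hApos : 0 < A := by positivity
  set h := (p.2 - (z k).2) / (2 * A) with hh
  have hh' : p.2 - (z k).2 = 2 * A * h := by rw [hh]; field_simp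
  have hsmall : |h| < δ := by
    have h₁ : |p.2| ≤ B := (norm_snd_le p).trans (hB p hp)
    have h₂ : |(z k).2| ≤ B := (norm_snd_le (z k)).trans (hB _ (hzC k))
    have h₃ : 2 * A * |h| ≤ 2 * B := by
      have : |p.2 - (z k).2| = 2 * A * |h| := by
        rw [hh', abs_mul, abs_of_pos (by positivity : 0 < 2 * A)]
      rw [← this]
      linarith [abs_sub p.2 (z k).2]
    have h₄ : B + 1 ≤ A * δ := by
      rw [hA, add_mul, div_mul_cancel₀ _ hδ.ne']
      nlinarith
    by_contra! h₅
    nlinarith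
  have h₁ : |(z (k + h)).2 - (z k).2| ≤ c * |h| := by
    have := @hδc (k + h) (by simpa using hsmall)
    simpa using this
  have h₂ : h * ((z (k + h)).2 - (z k).2) ≤ A * h ^ 2 := by
    calc h * ((z (k + h)).2 - (z k).2) ≤ |h * ((z (k + h)).2 - (z k).2)| := le_abs_self _
      _ = |h| * |(z (k + h)).2 - (z k).2| := abs_mul _ _
      _ ≤ |h| * (A * |h|) := by
        gcongr
        refine h₁.trans ?_
        gcongr
        rw [hA]
        linarith [show 0 ≤ (B + 1) / δ by positivity]
      _ = A * h ^ 2 := by rw [← sq_abs h]; ring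
  have h₃ := hz (k + h) p hp
  have h₄ := hz k _ (hzC (k + h))
  have h₅ : A * h ^ 2 ≤ (p.1 - k * p.2) - ((z k).1 - k * (z k).2) := by
    have : h * p.2 = h * (z k).2 + 2 * A * h ^ 2 := by
      linear_combination h * hh'
    nlinarith
  rw [hh']
  nlinarith

/-- A polynomial that is `O((t - a) ^ m)` along some approach to `a` is divisible by
`(X - a) ^ m`. -/
theorem X_sub_C_pow_dvd_of_eventually_le {G : ℝ[X]} {a K : ℝ} {m : ℕ} {F : Filter ℝ} [F.NeBot]
    (hF : F ≤ 𝓝[≠] a) (h : ∀ᶠ t in F, |G.eval t| ≤ K * |t - a| ^ m) : (X - C a) ^ m ∣ G := by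
  rcases eq_or_ne G 0 with rfl | hG
  · simp
  obtain ⟨H, hH, hdvd⟩ := exists_eq_pow_rootMultiplicity_mul_and_not_dvd G hG a
  set j := G.rootMultiplicity a
  by_contra hm
  have hj : j < m := by
    by_contra! hj
    exact hm ((pow_dvd_pow _ hj).trans ⟨H, hH⟩)
  apply hdvd
  rw [dvd_iff_isRoot, IsRoot, ← abs_eq_zero]
  refine le_antisymm ?_ (abs_nonneg _)
  have t₁ : Tendsto (fun t => |H.eval t|) F (𝓝 |H.eval a|) :=
    (H.continuous.abs.tendsto a).mono_left (hF.trans nhdsWithin_le_nhds)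
  have t₂ : Tendsto (fun t => K * |t - a| ^ (m - j)) F (𝓝 0) := by
    have : Continuous fun t => K * |t - a| ^ (m - j) := by fun_prop
    have h0 := (this.tendsto a).mono_left (hF.trans nhdsWithin_le_nhds)
    simpa [Nat.sub_ne_zero_of_lt hj] using h0
  refine le_of_tendsto_of_tendsto t₁ t₂ ?_
  filter_upwards [h, hF self_mem_nhdsWithin] with t ht hta
  have hpos : 0 < |t - a| := abs_pos.2 (sub_ne_zero.2 hta)
  rw [hH, eval_mul, eval_pow, eval_sub, eval_X, eval_C, abs_mul, abs_pow] at ht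
  have : |t - a| ^ j * |H.eval t| ≤ |t - a| ^ j * (K * |t - a| ^ (m - j)) := by
    refine ht.trans_eq ?_
    rw [← Nat.add_sub_cancel' hj.le, pow_add]
    simp
    ring
  exact le_of_mul_le_mul_left this (by positivity)

/-- A nonnegative function whose `m`-th power is a polynomial of degree at most `m` and which is
dominated by square roots at both endpoints of an interval is a semi-ellipse. -/
theorem exists_eq_mul_sqrt {a b : ℝ} (hab : a < b) {M : ℝ → ℝ} {P : ℝ[X]} {m : ℕ} (hm : 1 ≤ m)
    (hM : ∀ t, 0 ≤ M t) (hP : ∀ t ∈ Ioo a b, M t ^ m = P.eval t) (hdeg : P.natDegree ≤ m)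
    {A B : ℝ} (hA : ∀ t ∈ Ioo a b, M t ^ 2 ≤ A * (t - a))
    (hB : ∀ t ∈ Ioo a b, M t ^ 2 ≤ B * (b - t)) :
    ∃ c : ℝ, 0 ≤ c ∧ ∀ t ∈ Ioo a b, M t = c * √((t - a) * (b - t)) := by
  have hpow : ∀ t ∈ Ioo a b, |(P ^ 2).eval t| = (M t ^ 2) ^ m := fun t ht => by
    rw [eval_pow, ← hP t ht, abs_of_nonneg (by positivity)]
    ring
  have d₁ : (X - C a) ^ m ∣ P ^ 2 := by
    refine X_sub_C_pow_dvd_of_eventually_le (F := 𝓝[>] a) (K := A ^ m)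
      (nhdsWithin_mono _ fun _ h => ne_of_gt h) ?_
    filter_upwards [Ioo_mem_nhdsGT hab] with t ht
    rw [hpow t ht, ← mul_pow, abs_of_pos (sub_pos.2 ht.1)]
    exact pow_le_pow_left₀ (by positivity) (hA t ht) m
  have d₂ : (X - C b) ^ m ∣ P ^ 2 := by
    refine X_sub_C_pow_dvd_of_eventually_le (F := 𝓝[<] b) (K := B ^ m)
      (nhdsWithin_mono _ fun _ h => ne_of_lt h) ?_
    filter_upwards [Ioo_mem_nhdsLT hab] with t ht
    rw [hpow t ht, ← mul_pow, abs_sub_comm, abs_of_pos (sub_pos.2 ht.2)]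
    exact pow_le_pow_left₀ (by positivity) (hB t ht) m
  have hcop : IsCoprime ((X - C a) ^ m) ((X - C b) ^ m) :=
    (isCoprime_X_sub_C_of_isUnit_sub (sub_ne_zero.2 hab.ne).isUnit).pow
  obtain ⟨H, hH⟩ := hcop.mul_dvd d₁ d₂
  have hHdeg : H.natDegree = 0 := by
    rcases eq_or_ne H 0 with rfl | hH0
    · simp
    have hmon : ((X - C a) ^ m * (X - C b) ^ m).Monic :=
      ((monic_X_sub_C a).pow m).mul ((monic_X_sub_C b).pow m)
    have h₁ := congrArg natDegree hH
    rw [hmon.natDegree_mul' hH0, ((monic_X_sub_C a).pow m).natDegree_mul ((monic_X_sub_C b).pow m),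
      natDegree_pow, natDegree_pow, natDegree_pow, natDegree_X_sub_C, natDegree_X_sub_C] at h₁
    omega
  rw [eq_C_of_natDegree_eq_zero hHdeg] at hH
  set e := H.coeff 0
  have hval : ∀ t ∈ Ioo a b, M t ^ (2 * m) = |e| * ((t - a) * (b - t)) ^ m := fun t ht => by
    rw [pow_mul, ← hpow t ht, hH]
    simp only [eval_mul, eval_pow, eval_sub, eval_X, eval_C, abs_mul, abs_pow]
    rw [abs_of_pos (sub_pos.2 ht.1), abs_sub_comm, abs_of_pos (sub_pos.2 ht.2), mul_pow]
    ring
  refine ⟨|e| ^ (((2 * m : ℕ) : ℝ)⁻¹), by positivity, fun t ht => ?_⟩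
  have h₂m : 2 * m ≠ 0 := by omega
  rw [← pow_left_inj₀ (hM t) (by positivity) h₂m, hval t ht, mul_pow (_ ^ _) √_,
    Real.rpow_inv_natCast_pow (abs_nonneg e) h₂m, pow_mul √_,
    Real.sq_sqrt (mul_nonneg (sub_nonneg.2 ht.1.le) (sub_nonneg.2 ht.2.le))]

theorem hasDerivAt_mul_sqrt_self {w : ℝ → ℝ} {w' t : ℝ} (hw : HasDerivAt w w' t) (ht : 0 < w t) :
    HasDerivAt (fun t => w t * √(w t)) (3 / 2 * w' * √(w t)) t := by
  refine (hw.mul (hw.sqrt ht.ne')).congr_deriv ?_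
  have := Real.sq_sqrt ht.le
  have h0 : √(w t) ≠ 0 := (Real.sqrt_pos.2 ht).ne'
  field_simp
  rw [this]
  ring

/-- First and second moment identities for the semi-ellipse density on an interval. -/
theorem integral_semiellipse_moments {a b : ℝ} (hab : a < b) :
    (∫ t in a..b, (t - (a + b) / 2) * √((t - a) * (b - t)) = 0) ∧
    ∫ t in a..b, (((b - a) / 2) ^ 2 - 4 * (t - (a + b) / 2) ^ 2) * √((t - a) * (b - t)) = 0 := by
  have hw : ∀ t, HasDerivAt (fun t => (t - a) * (b - t)) (-2 * (t - (a + b) / 2)) t := fun t => by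
    refine (((hasDerivAt_id t).sub_const a).mul ((hasDerivAt_id t).const_sub b)).congr_deriv ?_
    simp only [id]
    ring
  have hpos : ∀ t ∈ Ioo a b, 0 < (t - a) * (b - t) := fun t ht =>
    mul_pos (sub_pos.2 ht.1) (sub_pos.2 ht.2)
  constructor
  · rw [intervalIntegral.integral_eq_sub_of_hasDerivAt_of_le hab.le
      (f := fun t => -(1 / 3) * (((t - a) * (b - t)) * √((t - a) * (b - t))))
      (Continuous.continuousOn (by fun_prop)) (fun t ht => ?_)
      (Continuous.intervalIntegrable (by fun_prop) _ _)]
    · simp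
    · refine ((hasDerivAt_mul_sqrt_self (hw t) (hpos t ht)).const_mul (-(1 / 3))).congr_deriv ?_
      ring
  · rw [intervalIntegral.integral_eq_sub_of_hasDerivAt_of_le hab.le
      (f := fun t => (t - (a + b) / 2) * (((t - a) * (b - t)) * √((t - a) * (b - t))))
      (Continuous.continuousOn (by fun_prop)) (fun t ht => ?_)
      (Continuous.intervalIntegrable (by fun_prop) _ _)]
    · simp
    · refine (((hasDerivAt_id t).sub_const ((a + b) / 2)).mul
        (hasDerivAt_mul_sqrt_self (hw t) (hpos t ht))).congr_deriv ?_
      simp only [id]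
      ring

/-- Fubini's theorem along the lines `x = t + k y`. -/
theorem setIntegral_comp_sub_mul_eq {C : Set (ℝ × ℝ)} (hC : IsCompact C) (k : ℝ) {g : ℝ → ℝ}
    (hg : Continuous g) :
    ∫ p in C, g (p.1 - k * p.2) =
      ∫ t, g t * (volume {y : ℝ | (t + k * y, y) ∈ C}).toReal := by
  set D : Set (ℝ × ℝ) := {p | (p.1 + k * p.2, p.2) ∈ C} with hD
  have hDmem : ∀ t y, (t, y) ∈ D ↔ (t + k * y, y) ∈ C := fun _ _ => Iff.rfl
  have hDC : D = (fun p : ℝ × ℝ => (p.1 - k * p.2, p.2)) '' C := by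
    ext ⟨t, y⟩
    constructor
    · intro h
      exact ⟨_, h, by simp⟩
    · rintro ⟨⟨x, y'⟩, h, he⟩
      simp only [Prod.mk.injEq] at he
      obtain ⟨rfl, rfl⟩ := he
      simpa [hD] using h
  have hDcomp : IsCompact D := hDC ▸ hC.image (by fun_prop)
  have i₁ : Integrable (C.indicator fun p : ℝ × ℝ => g (p.1 - k * p.2)) :=
    (ContinuousOn.integrableOn_compact hC (by fun_prop)).integrable_indicator hC.measurableSet
  have i₂ : Integrable (D.indicator fun p : ℝ × ℝ => g p.1) :=
    (ContinuousOn.integrableOn_compact hDcomp (by fun_prop)).integrable_indicator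
      hDcomp.measurableSet
  rw [← integral_indicator hC.measurableSet, Measure.volume_eq_prod, integral_prod_symm _ i₁]
  have h₁ : ∀ y : ℝ, ∫ x, C.indicator (fun p : ℝ × ℝ => g (p.1 - k * p.2)) (x, y) =
      ∫ t, D.indicator (fun p : ℝ × ℝ => g p.1) (t, y) := fun y => by
    rw [← integral_add_right_eq_self _ (k * y)]
    congr 1
    ext t
    by_cases h : (t, y) ∈ D
    · rw [indicator_of_mem h, indicator_of_mem ((hDmem t y).1 h)]
      simp
    · rw [indicator_of_notMem h, indicator_of_notMem (mt (hDmem t y).2 h)]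
  simp_rw [h₁]
  rw [← integral_prod_symm _ i₂, integral_prod _ i₂]
  congr 1
  ext t
  have hm : MeasurableSet {y : ℝ | (t + k * y, y) ∈ C} :=
    (hC.isClosed.preimage (by fun_prop : Continuous fun y : ℝ => (t + k * y, y))).measurableSet
  have h₂ : (fun y => D.indicator (fun p : ℝ × ℝ => g p.1) (t, y)) =
      {y : ℝ | (t + k * y, y) ∈ C}.indicator fun _ => g t := by
    ext y
    by_cases h : (t, y) ∈ D
    · rw [indicator_of_mem h,
        indicator_of_mem (show y ∈ {y : ℝ | (t + k * y, y) ∈ C} from (hDmem t y).1 h)]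
    · rw [indicator_of_notMem h,
        indicator_of_notMem (show y ∉ {y : ℝ | (t + k * y, y) ∈ C} from mt (hDmem t y).2 h)]
  rw [h₂, integral_indicator hm]
  simp [Measure.real, mul_comm]

/-- The chords of a compact convex planar set along the lines `x = t + k y`. -/
theorem exists_chord_endpoints {C : Set (ℝ × ℝ)} (hC : IsCompact C) (hconv : Convex ℝ C) {k t : ℝ}
    (hne : ∃ p ∈ C, p.1 - k * p.2 = t) :
    ∃ y₁ y₂ : ℝ, (t + k * y₁, y₁) ∈ frontier C ∧ (t + k * y₂, y₂) ∈ frontier C ∧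
      (volume {y : ℝ | (t + k * y, y) ∈ C}).toReal = y₂ - y₁ := by
  set S : Set ℝ := {y : ℝ | (t + k * y, y) ∈ C} with hS
  have hmem : ∀ y, y ∈ S ↔ (t + k * y, y) ∈ C := fun _ => Iff.rfl
  have hcont : Continuous fun y : ℝ => (t + k * y, y) := by fun_prop
  have hScomp : IsCompact S :=
    (hC.image continuous_snd).of_isClosed_subset (hC.isClosed.preimage hcont)
      fun y hy => ⟨_, hy, rfl⟩
  have hSconv : Convex ℝ S := by
    intro y hy z hz u v hu hv huv
    have := hconv hy hz hu hv huv
    rw [hmem]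
    convert this using 1
    ext
    · simp
      linear_combination -t * huv
    · simp
  have hSne : S.Nonempty := by
    obtain ⟨p, hp, rfl⟩ := hne
    exact ⟨p.2, by rw [hmem]; simpa using hp⟩
  have hIcc := eq_Icc_of_connected_compact ⟨hSne, hSconv.isPreconnected⟩ hScomp
  have hle : sInf S ≤ sSup S := by
    by_contra! h
    rw [Icc_eq_empty h.not_ge] at hIcc
    exact hSne.ne_empty hIcc
  have hfr : ∀ y ∈ S, (∀ᶠ z in 𝓝 y, z ∈ S) → y ≠ sInf S ∧ y ≠ sSup S := by
    intro y hy hev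
    have h₁ : Icc (sInf S) (sSup S) ∈ 𝓝 y := by rw [← hIcc]; exact hev
    rw [Icc_mem_nhds_iff] at h₁
    exact ⟨h₁.1.ne', h₁.2.ne⟩
  have hfr' : ∀ y ∈ S, (y = sInf S ∨ y = sSup S) → (t + k * y, y) ∈ frontier C := by
    intro y hy hor
    rw [hC.isClosed.frontier_eq]
    refine ⟨hy, fun hint => ?_⟩
    have h₁ : ∀ᶠ z in 𝓝 y, z ∈ S :=
      hcont.continuousAt.eventually (mem_interior_iff_mem_nhds.1 hint)
    have := hfr y hy h₁
    tauto
  refine ⟨sInf S, sSup S, hfr' _ (hScomp.sInf_mem hSne) (Or.inl rfl),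
    hfr' _ (hScomp.sSup_mem hSne) (Or.inr rfl), ?_⟩
  conv_lhs => rw [hIcc]
  rw [Real.volume_Icc, ENNReal.toReal_ofReal (sub_nonneg.2 hle)]

theorem ae_chord_moments {C : Set (ℝ × ℝ)} (hC : IsCompact C) (hconv : Convex ℝ C)
    (h0 : (0 : ℝ × ℝ) ∈ interior C) {R : MvPolynomial (Fin 2) ℝ} (hR : R ≠ 0)
    (hRC : ∀ p ∈ frontier C, MvPolynomial.eval ![p.1, p.2] R = 0) {m : ℕ} (hm : 1 ≤ m)
    (hch : ∀ k t₀ : ℝ, (∃ r ∈ Ico (0 : ℝ) 1, ∃ p ∈ C, t₀ = r * (p.1 - k * p.2)) →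
      ∃ P : ℝ[X], ∀ᶠ t in 𝓝 t₀, (volume {y : ℝ | (t + k * y, y) ∈ C}).toReal ^ m = P.eval t) :
    ∀ᵐ k : ℝ, ∃ a b : ℝ, (∃ z ∈ C, z.1 - k * z.2 = a) ∧ (∃ z ∈ C, z.1 - k * z.2 = b) ∧
      (∀ p ∈ C, p.1 - k * p.2 ∈ Icc a b) ∧
      (∫ p in C, (p.1 - k * p.2 - (a + b) / 2)) = 0 ∧
      ∫ p in C, (((b - a) / 2) ^ 2 - 4 * (p.1 - k * p.2 - (a + b) / 2) ^ 2) = 0 := by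
  obtain ⟨L, hL, hLdeg⟩ := exists_polynomial_natDegree_le hR
  have hne : C.Nonempty := ⟨0, interior_subset h0⟩
  have hfin : ∀ᵐ k : ℝ, L.eval k ≠ 0 := by
    have : {k | L.IsRoot k}.Finite := finite_setOfPred_isRoot hL
    have h := measure_eq_zero_iff_ae_notMem.1 (this.measure_zero volume)
    exact h
  have hneg : ∀ᵐ k : ℝ, ∃ z ∈ C, ∃ A : ℝ, 0 < A ∧ ∀ p ∈ C,
      (p.2 - z.2) ^ 2 ≤ A * ((z.1 - k * z.2) - (p.1 - k * p.2)) := by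
    filter_upwards [ae_exists_quadratic_growth hC.neg hne.neg] with k ⟨z, hz, A, hA, h⟩
    refine ⟨-z, hz, A, hA, fun p hp => ?_⟩
    have := h (-p) (by simpa using hp)
    simp only [Prod.fst_neg, Prod.snd_neg] at this ⊢
    nlinarith
  obtain ⟨ε, hε, hball⟩ := Metric.mem_nhds_iff.1 (mem_interior_iff_mem_nhds.1 h0)
  have hmemε : ∀ s : ℝ, |s| < ε → ((s, 0) : ℝ × ℝ) ∈ C := fun s hs => hball (by
    simpa [Prod.dist_eq, hε] using hs)
  filter_upwards [ae_exists_quadratic_growth hC hne, hneg, hfin] with k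
    ⟨za, hza, A, hA, hA'⟩ ⟨zb, hzb, B, hB, hB'⟩ hk
  set a := za.1 - k * za.2 with ha
  set b := zb.1 - k * zb.2 with hb
  have hIcc : ∀ p ∈ C, p.1 - k * p.2 ∈ Icc a b := fun p hp => by
    constructor
    · have := (sq_nonneg _).trans (hA' p hp)
      exact sub_nonneg.1 (nonneg_of_mul_nonneg_right this hA)
    · have := (sq_nonneg _).trans (hB' p hp)
      exact sub_nonneg.1 (nonneg_of_mul_nonneg_right this hB)
  have ha0 : a < 0 := by
    have := (hIcc _ (hmemε (-(ε / 2)) (by rw [abs_neg, abs_of_pos] <;> linarith))).1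
    simp at this
    linarith
  have hb0 : 0 < b := by
    have := (hIcc _ (hmemε (ε / 2) (by rw [abs_of_pos] <;> linarith))).2
    simp at this
    linarith
  have hab : a < b := ha0.trans hb0
  replace hch := hch k
  have hchord := fun t => exists_chord_endpoints (k := k) (t := t) hC hconv
  have hfub := fun g => setIntegral_comp_sub_mul_eq (g := g) hC k
  have hM0 : ∀ t ∉ Icc a b, (volume {y : ℝ | (t + k * y, y) ∈ C}).toReal = 0 := fun t ht => by
    have : {y : ℝ | (t + k * y, y) ∈ C} = ∅ := by
      refine eq_empty_of_forall_notMem fun y hy => ht ?_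
      have := hIcc _ hy
      simpa using this
    simp [this]
  have hMnn : ∀ t, 0 ≤ (volume {y : ℝ | (t + k * y, y) ∈ C}).toReal :=
    fun _ => ENNReal.toReal_nonneg
  obtain ⟨M, hM⟩ : ∃ M : ℝ → ℝ, ∀ t, (volume {y : ℝ | (t + k * y, y) ∈ C}).toReal = M t :=
    ⟨_, fun _ => rfl⟩
  simp only [hM] at hch hchord hfub hM0 hMnn
  obtain ⟨P, hP⟩ : ∃ P : ℝ[X], ∀ t ∈ Ioo a b, M t ^ m = P.eval t := by
    refine exists_polynomial_of_locally_polynomial fun t ht => hch t ?_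
    rcases le_total 0 t with h | h
    · refine ⟨t / b, ⟨by positivity, (div_lt_one hb0).2 ht.2⟩, zb, hzb, ?_⟩
      rw [← hb, div_mul_cancel₀ _ hb0.ne']
    · refine ⟨t / a, ⟨div_nonneg_of_nonpos h ha0.le, (div_lt_one_of_neg ha0).2 ht.1⟩, za, hza, ?_⟩
      rw [← ha, div_mul_cancel₀ _ ha0.ne]
  have hnec : ∀ t ∈ Ioo a b, ∃ p ∈ C, p.1 - k * p.2 = t := fun t ht => by
    refine ⟨((b - t) / (b - a)) • za + ((t - a) / (b - a)) • zb, hconv hza hzb ?_ ?_ ?_, ?_⟩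
    · exact div_nonneg (sub_nonneg.2 ht.2.le) (sub_nonneg.2 hab.le)
    · exact div_nonneg (sub_nonneg.2 ht.1.le) (sub_nonneg.2 hab.le)
    · field_simp [sub_ne_zero.2 hab.ne']
      ring
    · have h₁ : (b - t) / (b - a) * a + (t - a) / (b - a) * b = t := by
        field_simp [sub_ne_zero.2 hab.ne']
        ring
      simp only [Prod.fst_add, Prod.snd_add, Prod.smul_fst, Prod.smul_snd, smul_eq_mul]
      linear_combination h₁ - (b - t) / (b - a) * ha - (t - a) / (b - a) * hb
  choose! y₁ y₂ hy₁ hy₂ hy using fun t ht => hchord t (hnec t ht)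
  have hfrC : frontier C ⊆ C := hC.isClosed.frontier_subset
  have hval : ∀ t y : ℝ, (t + k * y, y).1 - k * (t + k * y, y).2 = t := fun t y => by simp
  have hdeg : P.natDegree ≤ m := by
    refine hLdeg k hk a b hab y₁ y₂ P m (fun t ht => ?_) (fun t ht => ?_) fun t ht => ?_
    · exact hRC (t + k * y₁ t, y₁ t) (hy₁ t ht)
    · exact hRC (t + k * y₂ t, y₂ t) (hy₂ t ht)
    · rw [← hy t ht, ← hP t ht]
  obtain ⟨c, -, hMc⟩ : ∃ c : ℝ, 0 ≤ c ∧ ∀ t ∈ Ioo a b, M t = c * √((t - a) * (b - t)) := by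
    refine exists_eq_mul_sqrt (A := 4 * A) (B := 4 * B) hab hm hMnn hP hdeg
      (fun t ht => ?_) fun t ht => ?_
    · have h₁ := hA' _ (hfrC (hy₁ t ht))
      have h₂ := hA' _ (hfrC (hy₂ t ht))
      rw [hval] at h₁ h₂
      rw [hy t ht]
      nlinarith [sq_nonneg (y₂ t - za.2 + (y₁ t - za.2))]
    · have h₁ := hB' _ (hfrC (hy₁ t ht))
      have h₂ := hB' _ (hfrC (hy₂ t ht))
      rw [hval] at h₁ h₂
      rw [hy t ht]
      nlinarith [sq_nonneg (y₂ t - zb.2 + (y₁ t - zb.2))]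
  have hint : ∀ g : ℝ → ℝ, Continuous g → ∫ p in C, g (p.1 - k * p.2) =
      c * ∫ t in a..b, g t * √((t - a) * (b - t)) := fun g hg => by
    rw [hfub g hg, intervalIntegral.integral_of_le hab.le,
      integral_Ioc_eq_integral_Ioo, ← integral_const_mul,
      ← setIntegral_eq_integral_of_forall_compl_eq_zero (s := Icc a b)
        (fun t ht => by rw [hM0 t ht, mul_zero]), integral_Icc_eq_integral_Ioo]
    refine setIntegral_congr_fun measurableSet_Ioo fun t ht => ?_
    simp only [hMc t ht]
    ring
  obtain ⟨m₁, m₂⟩ := integral_semiellipse_moments hab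
  refine ⟨a, b, ⟨za, hza, rfl⟩, ⟨zb, hzb, rfl⟩, hIcc, ?_, ?_⟩
  · rw [hint (fun t => t - (a + b) / 2) (by fun_prop), m₁, mul_zero]
  · rw [hint (fun t => ((b - a) / 2) ^ 2 - 4 * (t - (a + b) / 2) ^ 2) (by fun_prop), m₂, mul_zero]

/-- A planar convex body whose width and midpoint in almost every direction agree with those of an
ellipse is a conic domain. -/
theorem exists_conic_of_ae_width {C : Set (ℝ × ℝ)} (hC : IsCompact C) (hconv : Convex ℝ C)
    (h0 : (0 : ℝ × ℝ) ∈ interior C) {c₁ c₂ α β γ : ℝ}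
    (h : ∀ᵐ k : ℝ, ∃ a b : ℝ, (∃ z ∈ C, z.1 - k * z.2 = a) ∧ (∃ z ∈ C, z.1 - k * z.2 = b) ∧
      (∀ p ∈ C, p.1 - k * p.2 ∈ Icc a b) ∧ (a + b) / 2 = c₁ - k * c₂ ∧
      ((b - a) / 2) ^ 2 = α - 2 * k * β + k ^ 2 * γ) :
    ∃ A B D l₁ l₂ : ℝ, ∀ x y, (x, y) ∈ C ↔
      A * x ^ 2 + B * (x * y) + D * y ^ 2 + (l₁ * x + l₂ * y) ≤ 1 := by
  have hdense := Measure.dense_of_ae h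
  have hstrip : ∀ x y, (x, y) ∈ C → ∀ k : ℝ,
      ((x - c₁) - k * (y - c₂)) ^ 2 ≤ α - 2 * k * β + k ^ 2 * γ := by
    intro x y hp k
    have hcl : IsClosed {k : ℝ | ((x - c₁) - k * (y - c₂)) ^ 2 ≤ α - 2 * k * β + k ^ 2 * γ} :=
      isClosed_le (by fun_prop) (by fun_prop)
    refine closure_minimal ?_ hcl (hdense k)
    rintro k ⟨a, b, -, -, hI, hmid, hw⟩
    obtain ⟨h₁, h₂⟩ := hI _ hp
    change ((x - c₁) - k * (y - c₂)) ^ 2 ≤ _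
    rw [← hw]
    simp only at h₁ h₂
    exact sq_le_sq' (by linarith) (by linarith)
  obtain ⟨ε, hε, hball⟩ := Metric.mem_nhds_iff.1 (mem_interior_iff_mem_nhds.1 h0)
  set r := ε / 2 with hr
  have hrpos : 0 < r := by positivity
  have hrε : |r| < ε := by rw [abs_of_pos hrpos]; linarith
  have hmem : ∀ x y : ℝ, |x| < ε → |y| < ε → (x, y) ∈ C := fun x y hx hy => hball (by
    simpa [Prod.dist_eq] using ⟨hx, hy⟩)
  have hlow : ∀ k : ℝ, r ^ 2 * (1 + k ^ 2) ≤ 2 * (α - 2 * k * β + k ^ 2 * γ) := by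
    intro k
    have e₁ := hstrip _ _ (hmem r 0 hrε (by simpa using hε)) k
    have e₂ := hstrip _ _ (hmem (-r) 0 (by rwa [abs_neg]) (by simpa using hε)) k
    have e₃ := hstrip _ _ (hmem 0 r (by simpa using hε) hrε) k
    have e₄ := hstrip _ _ (hmem 0 (-r) (by simpa using hε) (by rwa [abs_neg])) k
    nlinarith [sq_nonneg (c₁ - k * c₂)]
  have hα : r ^ 2 / 2 ≤ α := by
    have := hlow 0
    norm_num at this
    linarith
  have hr2 : 0 < r ^ 2 := by positivity
  have hdisc : β ^ 2 ≤ (γ - r ^ 2 / 2) * (α - r ^ 2 / 4) := by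
    have := discrim_le_zero (a := γ - r ^ 2 / 2) (b := -2 * β) (c := α - r ^ 2 / 4)
      (fun k => by nlinarith [hlow k])
    unfold discrim at this
    linarith
  have hγ : r ^ 2 / 2 ≤ γ := by
    by_contra! hcon
    nlinarith [sq_nonneg β, mul_pos (sub_pos.2 hcon) (by linarith : 0 < α - r ^ 2 / 4)]
  have hΔ : 0 < α * γ - β ^ 2 := by nlinarith
  have hsub : ∀ x y, (x, y) ∈ C → γ * (x - c₁) ^ 2 - 2 * β * ((x - c₁) * (y - c₂)) +
      α * (y - c₂) ^ 2 ≤ α * γ - β ^ 2 := by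
    intro x y hp
    have := discrim_le_zero (a := γ - (y - c₂) ^ 2) (b := -2 * (β - (x - c₁) * (y - c₂)))
      (c := α - (x - c₁) ^ 2) (fun k => by linarith [hstrip x y hp k])
    unfold discrim at this
    linarith
  have hsup : ∀ x y, γ * (x - c₁) ^ 2 - 2 * β * ((x - c₁) * (y - c₂)) +
      α * (y - c₂) ^ 2 ≤ α * γ - β ^ 2 → (x, y) ∈ C := by
    intro x y hN
    by_contra hxy
    obtain ⟨f, u, hfC, hfx⟩ := geometric_hahn_banach_closed_point hconv hC.isClosed hxy
    have hf : ∀ p : ℝ × ℝ, f p = f (1, 0) * p.1 + f (0, 1) * p.2 := fun p => by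
      have : p = p.1 • ((1, 0) : ℝ × ℝ) + p.2 • ((0, 1) : ℝ × ℝ) := by ext <;> simp
      conv_lhs => rw [this, map_add, map_smul, map_smul]
      simp [mul_comm]
    obtain ⟨B, hB⟩ : ∃ B, ∀ p ∈ C, ‖(x, y) - p‖ ≤ B :=
      (hC.image (by fun_prop : Continuous fun p : ℝ × ℝ => ‖(x, y) - p‖)).bddAbove.imp
        fun B hB p hp => hB ⟨p, hp, rfl⟩
    have hB0 : 0 ≤ B := (norm_nonneg _).trans (hB 0 (interior_subset h0))
    set η := f (x, y) - u with hη
    have hηpos : 0 < η := sub_pos.2 hfx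
    set δ := η / (2 * (B + 1)) with hδ
    have hδpos : 0 < δ := by positivity
    have hδB : 2 * δ * B < η := by
      have : 2 * δ * (B + 1) = η := by rw [hδ]; field_simp
      nlinarith
    obtain ⟨s, hs0, hs⟩ : ∃ s : ℝ, s ≠ 0 ∧ |s - f (1, 0)| < δ := by
      by_cases h : f (1, 0) = 0
      · exact ⟨δ / 2, by positivity, by rw [h, sub_zero, abs_of_pos] <;> linarith⟩
      · exact ⟨_, h, by simpa using hδpos⟩
    obtain ⟨k, hkδ, a, b, ⟨za, hza, rfl⟩, ⟨zb, hzb, rfl⟩, hI, hmid, hw⟩ :=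
      hdense.inter_open_nonempty {k : ℝ | |-k * s - f (0, 1)| < δ}
        (isOpen_lt (by fun_prop) continuous_const)
        ⟨-f (0, 1) / s, by
          change |-(-f (0, 1) / s) * s - f (0, 1)| < δ
          rw [neg_mul, div_mul_cancel₀ _ hs0]
          simpa using hδpos⟩
    replace hkδ : |-k * s - f (0, 1)| < δ := hkδ
    have hsep : ∀ p ∈ C, 0 < s * ((x - k * y) - (p.1 - k * p.2)) := by
      intro p hp
      have e₁ : η ≤ f (1, 0) * (x - p.1) + f (0, 1) * (y - p.2) := by
        have := (hfC p hp).le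
        rw [hf p] at this
        rw [hη, hf (x, y)]
        simp only
        linarith
      have b₁ : |x - p.1| ≤ B := (norm_fst_le ((x, y) - p)).trans (hB p hp)
      have b₂ : |y - p.2| ≤ B := (norm_snd_le ((x, y) - p)).trans (hB p hp)
      have e₂ : |(s - f (1, 0)) * (x - p.1)| ≤ δ * B := by
        rw [abs_mul]; gcongr
      have e₃ : |(-k * s - f (0, 1)) * (y - p.2)| ≤ δ * B := by
        rw [abs_mul]; gcongr
      have := neg_abs_le ((s - f (1, 0)) * (x - p.1))
      have := neg_abs_le ((-k * s - f (0, 1)) * (y - p.2))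
      linarith
    have hcs : ((x - c₁) - k * (y - c₂)) ^ 2 ≤
        ((zb.1 - k * zb.2 - (za.1 - k * za.2)) / 2) ^ 2 := by
      rw [hw]
      have hq : 0 ≤ α - 2 * k * β + k ^ 2 * γ := hw ▸ sq_nonneg _
      refine le_of_mul_le_mul_left ?_ hΔ
      have hCS : (γ * (x - c₁) ^ 2 - 2 * β * ((x - c₁) * (y - c₂)) + α * (y - c₂) ^ 2) *
          (α - 2 * k * β + k ^ 2 * γ) = (α * γ - β ^ 2) * ((x - c₁) - k * (y - c₂)) ^ 2 +
            ((γ * k - β) * (x - c₁) + (α - β * k) * (y - c₂)) ^ 2 := by ring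
      linarith [mul_le_mul_of_nonneg_right hN hq,
        sq_nonneg ((γ * k - β) * (x - c₁) + (α - β * k) * (y - c₂))]
    have hab : za.1 - k * za.2 ≤ zb.1 - k * zb.2 := (hI za hza).2
    obtain ⟨g₁, g₂⟩ := abs_le.1 ((sq_le_sq.1 hcs).trans_eq
      (abs_of_nonneg (by linarith : 0 ≤ (zb.1 - k * zb.2 - (za.1 - k * za.2)) / 2)))
    rcases lt_or_gt_of_ne hs0 with hs | hs
    · have := neg_of_mul_pos_right (hsep za hza) hs.le
      linarith
    · have := pos_of_mul_pos_right (hsep zb hzb) hs.le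
      linarith
  set N := γ * c₁ ^ 2 - 2 * β * (c₁ * c₂) + α * c₂ ^ 2 with hN
  have hF : 0 < α * γ - β ^ 2 - N := by
    have e₁ := hsub _ _ (hmem r 0 hrε (by simpa using hε))
    have e₂ := hsub _ _ (hmem (-r) 0 (by rwa [abs_neg]) (by simpa using hε))
    nlinarith
  refine ⟨γ / (α * γ - β ^ 2 - N), -2 * β / (α * γ - β ^ 2 - N), α / (α * γ - β ^ 2 - N),
    (-2 * γ * c₁ + 2 * β * c₂) / (α * γ - β ^ 2 - N),
    (2 * β * c₁ - 2 * α * c₂) / (α * γ - β ^ 2 - N), fun x y => ?_⟩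
  have e : γ / (α * γ - β ^ 2 - N) * x ^ 2 + -2 * β / (α * γ - β ^ 2 - N) * (x * y) +
      α / (α * γ - β ^ 2 - N) * y ^ 2 +
      ((-2 * γ * c₁ + 2 * β * c₂) / (α * γ - β ^ 2 - N) * x +
        (2 * β * c₁ - 2 * α * c₂) / (α * γ - β ^ 2 - N) * y) =
      (γ * (x - c₁) ^ 2 - 2 * β * ((x - c₁) * (y - c₂)) + α * (y - c₂) ^ 2 - N) /
        (α * γ - β ^ 2 - N) := by
    field_simp
    rw [hN]
    ring
  rw [e, div_le_one hF]
  constructor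
  · intro hp
    linarith [hsub x y hp]
  · intro hp
    exact hsup x y (by linarith)

/-- Planar bodies bounded by an algebraic curve with radical-polynomial chord functions are
conic domains. -/
theorem exists_conic_of_radical_polynomial_chords {C : Set (ℝ × ℝ)} (hC : IsCompact C)
    (hconv : Convex ℝ C)
    (h0 : (0 : ℝ × ℝ) ∈ interior C) {R : MvPolynomial (Fin 2) ℝ} (hR : R ≠ 0)
    (hRC : ∀ p ∈ frontier C, MvPolynomial.eval ![p.1, p.2] R = 0) {m : ℕ} (hm : 1 ≤ m)
    (hch : ∀ k t₀ : ℝ, (∃ r ∈ Ico (0 : ℝ) 1, ∃ p ∈ C, t₀ = r * (p.1 - k * p.2)) →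
      ∃ P : ℝ[X], ∀ᶠ t in 𝓝 t₀, (volume {y : ℝ | (t + k * y, y) ∈ C}).toReal ^ m = P.eval t) :
    ∃ A B D l₁ l₂ : ℝ, ∀ x y, (x, y) ∈ C ↔
      A * x ^ 2 + B * (x * y) + D * y ^ 2 + (l₁ * x + l₂ * y) ≤ 1 := by
  set V := volume.real C with hV
  have hVpos : 0 < V := ENNReal.toReal_pos
    (Measure.measure_pos_of_nonempty_interior _ ⟨0, h0⟩).ne' hC.measure_lt_top.ne
  have hI : ∀ f : ℝ × ℝ → ℝ, Continuous f → IntegrableOn f C := fun f hf =>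
    hf.continuousOn.integrableOn_compact hC
  set c₁ := (∫ p in C, p.1) / V with hc₁
  set c₂ := (∫ p in C, p.2) / V with hc₂
  refine exists_conic_of_ae_width hC hconv h0 (c₁ := c₁) (c₂ := c₂)
    (α := 4 * (∫ p in C, (p.1 - c₁) ^ 2) / V)
    (β := 4 * (∫ p in C, (p.1 - c₁) * (p.2 - c₂)) / V)
    (γ := 4 * (∫ p in C, (p.2 - c₂) ^ 2) / V) ?_
  filter_upwards [ae_chord_moments hC hconv h0 hR hRC hm hch] with k ⟨a, b, ha, hb, hab, m₁, m₂⟩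
  have hmid : (a + b) / 2 = c₁ - k * c₂ := by
    rw [integral_sub (hI _ (by fun_prop)) (hI _ (by fun_prop)),
      integral_sub (hI _ (by fun_prop)) (hI _ (by fun_prop)), integral_const_mul] at m₁
    simp only [integral_const, measureReal_restrict_apply_univ, smul_eq_mul] at m₁
    rw [hc₁, hc₂]
    field_simp
    field_simp at m₁
    linarith
  refine ⟨a, b, ha, hb, hab, hmid, ?_⟩
  have e : ∀ p : ℝ × ℝ, ((b - a) / 2) ^ 2 - 4 * (p.1 - k * p.2 - (a + b) / 2) ^ 2 =
      ((b - a) / 2) ^ 2 - (4 * (p.1 - c₁) ^ 2 - (8 * k) * ((p.1 - c₁) * (p.2 - c₂)) +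
        (4 * k ^ 2) * (p.2 - c₂) ^ 2) := fun p => by
    rw [hmid]; ring
  simp_rw [e] at m₂
  rw [integral_sub (hI _ (by fun_prop)) (hI _ (by fun_prop)),
    integral_add (hI _ (by fun_prop)) (hI _ (by fun_prop)),
    integral_sub (hI _ (by fun_prop)) (hI _ (by fun_prop)), integral_const_mul,
    integral_const_mul, integral_const_mul] at m₂
  simp only [integral_const, measureReal_restrict_apply_univ, smul_eq_mul, ← hV] at m₂
  field_simp
  field_simp at m₂
  linarith

/-- The sublevel set of a positive definite quadratic polynomial is an ellipsoid. -/
theorem exists_affineEquiv_image_closedBall {E : Type*} [NormedAddCommGroup E]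
    [InnerProductSpace ℝ E] [FiniteDimensional ℝ E] {q : QuadraticForm ℝ E} (hq : q.PosDef)
    (l : E →ₗ[ℝ] ℝ) :
    ∃ T : E ≃ᵃ[ℝ] E, {x | q x + l x ≤ 1} = T '' Metric.closedBall 0 1 := by
  obtain ⟨w, hw, ⟨e⟩⟩ := q.equivalent_one_zero_neg_one_weighted_sum_squared
  have hw1 : ∀ i, w i = 1 := fun i => by
    have hne : e.symm.toLinearEquiv (Pi.single i 1) ≠ 0 := by simp
    have hpos : 0 < w i := by
      have h := hq _ hne
      have h' : q (e.symm.toLinearEquiv (Pi.single i 1)) = w i := by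
        refine (e.symm.map_app (Pi.single i (1 : ℝ))).trans ?_
        rw [QuadraticMap.weightedSumSquares_apply, Finset.sum_eq_single i]
        · simp
        · intro j _ hj
          simp [Pi.single_eq_of_ne hj]
        · simp
      rwa [h'] at h
    rcases hw i with h | h | h <;> linarith
  have hqe : ∀ x, q x = ∑ i, e.toLinearEquiv x i ^ 2 := fun x => by
    rw [← e.map_app x, QuadraticMap.weightedSumSquares_apply]
    exact Finset.sum_congr rfl fun i _ => by rw [hw1, one_smul, sq]; rfl
  set c := e.toLinearEquiv.symm fun i => l (e.toLinearEquiv.symm (Pi.single i 1)) / 2 with hc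
  have hqc : ∀ x, q (x + c) = q x + l x + q c := fun x => by
    have hl : l x = ∑ i, e.toLinearEquiv x i * l (e.toLinearEquiv.symm (Pi.single i 1)) := by
      conv_lhs => rw [← e.toLinearEquiv.symm_apply_apply x, pi_eq_sum_univ' (e.toLinearEquiv x)]
      simp
    rw [hqe, hqe, hqe, hl, ← Finset.sum_add_distrib, ← Finset.sum_add_distrib]
    refine Finset.sum_congr rfl fun i _ => ?_
    rw [map_add, Pi.add_apply, hc, LinearEquiv.apply_symm_apply]
    ring
  have hc0 : 0 ≤ q c := hq.nonneg c
  set ρ := √(1 + q c) with hρ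
  have hρ0 : 0 < ρ := Real.sqrt_pos.2 (by linarith)
  have hρ2 : ρ ^ 2 = 1 + q c := Real.sq_sqrt (by linarith)
  set F : E ≃ₗ[ℝ] E := e.toLinearEquiv ≪≫ₗ (WithLp.linearEquiv 2 ℝ _).symm ≪≫ₗ
    (stdOrthonormalBasis ℝ E).repr.symm.toLinearEquiv ≪≫ₗ
    LinearEquiv.smulOfNeZero ℝ E ρ⁻¹ (inv_ne_zero hρ0.ne') with hF
  have hFn : ∀ x, ‖F x‖ ^ 2 = q x / ρ ^ 2 := fun x => by
    have : F x = ρ⁻¹ • (stdOrthonormalBasis ℝ E).repr.symm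
      (WithLp.toLp 2 (e.toLinearEquiv x)) := rfl
    rw [this, norm_smul, LinearIsometryEquiv.norm_map, mul_pow, EuclideanSpace.norm_sq_eq, hqe]
    simp
    ring
  refine ⟨F.symm.toAffineEquiv.trans (AffineEquiv.constVAdd ℝ E (-c)), ?_⟩
  ext x
  have hx : q x + l x ≤ 1 ↔ ‖F (x + c)‖ ≤ 1 := by
    rw [← sq_le_one_iff₀ (norm_nonneg _), hFn, div_le_one (by positivity), hρ2, hqc]
    constructor <;> intro h <;> linarith
  rw [mem_ofPred_eq, hx]
  constructor
  · exact fun h => ⟨F (x + c), by simpa using h, by simp⟩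
  · rintro ⟨y, hy, rfl⟩
    simpa using hy

theorem add_mul_eq_sq_of_forall_le_one_iff {a b g : ℝ} (hg : 0 < g)
    (h : ∀ s, 0 ≤ s → (a * s ^ 2 + b * s ≤ 1 ↔ s * g ≤ 1)) : a + b * g = g ^ 2 := by
  have hle := (h g⁻¹ (by positivity)).2 (inv_mul_cancel₀ hg.ne').le
  have hge : 1 ≤ a * g⁻¹ ^ 2 + b * g⁻¹ := by
    have ht : Tendsto (fun s => a * s ^ 2 + b * s) (𝓝[>] g⁻¹) (𝓝 (a * g⁻¹ ^ 2 + b * g⁻¹)) :=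
      (Continuous.tendsto (by fun_prop) _).mono_left nhdsWithin_le_nhds
    refine ge_of_tendsto ht ?_
    filter_upwards [self_mem_nhdsWithin] with s hs
    have hs' : g⁻¹ < s := hs
    by_contra! hcon
    have := (h s ((by positivity : 0 ≤ g⁻¹).trans hs'.le)).1 hcon.le
    rw [← le_div_iff₀ hg, one_div] at this
    linarith
  have := le_antisymm hle hge
  field_simp at this
  linarith

/-- A convex body whose sections by planes through an interior point are conic domains is an
ellipsoid. -/
theorem exists_affineEquiv_image_closedBall_of_planar_sections {E : Type*} [NormedAddCommGroup E]
    [InnerProductSpace ℝ E] [FiniteDimensional ℝ E] {K : Set E} (hK : IsCompact K)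
    (hconv : Convex ℝ K) (h0 : (0 : E) ∈ interior K)
    (h : ∀ u w : E, LinearIndependent ℝ ![u, w] → ∃ A B D l₁ l₂ : ℝ, ∀ x y : ℝ,
      x • u + y • w ∈ K ↔ A * x ^ 2 + B * (x * y) + D * y ^ 2 + (l₁ * x + l₂ * y) ≤ 1) :
    ∃ T : E ≃ᵃ[ℝ] E, K = T '' Metric.closedBall 0 1 := by
  have hK0 : K ∈ 𝓝 0 := mem_interior_iff_mem_nhds.1 h0
  have hmem : ∀ x, x ∈ K ↔ gauge K x ≤ 1 := fun x => by
    rw [gauge_le_one_iff_mem_closure hconv hK0, hK.isClosed.closure_eq]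
  have hpos : ∀ x, x ≠ 0 → 0 < gauge K x := fun x =>
    (gauge_pos (absorbent_nhds_zero hK0) (NormedSpace.isVonNBounded_of_isBounded ℝ hK.isBounded)).2
  have hsmul : ∀ (s : ℝ) x, 0 ≤ s → gauge K (s • x) = s * gauge K x :=
    fun s x hs => gauge_smul_of_nonneg hs x
  have hplane : ∀ u w : E, ∃ A B D l₁ l₂ : ℝ, ∀ x y : ℝ,
      gauge K (x • u + y • w) * gauge K (-(x • u + y • w)) =
        A * x ^ 2 + B * (x * y) + D * y ^ 2 ∧
      gauge K (x • u + y • w) - gauge K (-(x • u + y • w)) = l₁ * x + l₂ * y := by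
    intro u w
    have hline : ∀ (c : ℝ) (v : E), gauge K (c • v) * gauge K (-(c • v)) =
        c ^ 2 * (gauge K v * gauge K (-v)) ∧
        gauge K (c • v) - gauge K (-(c • v)) = c * (gauge K v - gauge K (-v)) := by
      intro c v
      rcases le_total 0 c with hc | hc
      · rw [← smul_neg, hsmul _ _ hc, hsmul _ _ hc]
        constructor <;> ring
      · rw [← neg_smul, ← neg_smul_neg c v, hsmul (-c) _ (by linarith),
          hsmul (-c) _ (by linarith)]
        constructor <;> ring
    rcases eq_or_ne u 0 with rfl | hu
    · refine ⟨0, 0, gauge K w * gauge K (-w), 0, gauge K w - gauge K (-w), fun x y => ?_⟩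
      rw [smul_zero, zero_add, (hline y w).1, (hline y w).2]
      constructor <;> ring
    by_cases hi : LinearIndependent ℝ ![u, w]
    · obtain ⟨A, B, D, l₁, l₂, hc⟩ := h u w hi
      refine ⟨A, B, D, l₁, l₂, fun x y => ?_⟩
      by_cases hv : x • u + y • w = 0
      · obtain ⟨rfl, rfl⟩ := LinearIndependent.pair_iff.1 hi x y hv
        simp
      have hg := hpos _ hv
      have hg' := hpos _ (neg_ne_zero.2 hv)
      have e₁ := add_mul_eq_sq_of_forall_le_one_iff
        (a := A * x ^ 2 + B * (x * y) + D * y ^ 2) (b := l₁ * x + l₂ * y) hg fun s hs => by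
          rw [← hsmul _ _ hs, ← hmem, smul_add, smul_smul, smul_smul, hc]
          ring_nf
      have e₂ := add_mul_eq_sq_of_forall_le_one_iff
        (a := A * x ^ 2 + B * (x * y) + D * y ^ 2) (b := -(l₁ * x + l₂ * y)) hg' fun s hs => by
          have : s • -(x • u + y • w) = (s * -x) • u + (s * -y) • w := by module
          rw [← hsmul _ _ hs, ← hmem, this, hc]
          ring_nf
      have e₃ : gauge K (x • u + y • w) - gauge K (-(x • u + y • w)) = l₁ * x + l₂ * y := by
        refine mul_right_cancel₀ (add_pos hg hg').ne' ?_
        linear_combination e₂ - e₁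
      exact ⟨by linear_combination -gauge K (x • u + y • w) * e₃ - e₁, e₃⟩
    · rw [LinearIndependent.pair_iff' hu] at hi
      push Not at hi
      obtain ⟨a, rfl⟩ := hi
      refine ⟨gauge K u * gauge K (-u), 2 * a * (gauge K u * gauge K (-u)),
        a ^ 2 * (gauge K u * gauge K (-u)), gauge K u - gauge K (-u),
        a * (gauge K u - gauge K (-u)), fun x y => ?_⟩
      have : x • u + y • a • u = (x + y * a) • u := by module
      rw [this, (hline _ u).1, (hline _ u).2]
      constructor <;> ring
  set q₀ : E → ℝ := fun x => gauge K x * gauge K (-x) with hq₀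
  set l₀ : E → ℝ := fun x => gauge K x - gauge K (-x) with hl₀
  replace hplane : ∀ u w : E, ∃ A B D l₁ l₂ : ℝ, ∀ x y : ℝ,
      q₀ (x • u + y • w) = A * x ^ 2 + B * (x * y) + D * y ^ 2 ∧
      l₀ (x • u + y • w) = l₁ * x + l₂ * y := hplane
  have hlsmul : ∀ (c : ℝ) x, l₀ (c • x) = c * l₀ x := fun c x => by
    obtain ⟨A, B, D, l₁, l₂, hc⟩ := hplane x 0
    have e₁ := (hc c 0).2
    have e₂ := (hc 1 0).2
    simp only [smul_zero, add_zero, one_smul] at e₁ e₂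
    rw [e₁, e₂]
    ring
  have hladd : ∀ x y, l₀ (x + y) = l₀ x + l₀ y := fun x y => by
    obtain ⟨A, B, D, l₁, l₂, hc⟩ := hplane x y
    have e₁ := (hc 1 0).2
    have e₂ := (hc 0 1).2
    have e₃ := (hc 1 1).2
    simp only [zero_smul, add_zero, zero_add, one_smul] at e₁ e₂ e₃
    rw [e₁, e₂, e₃]
    ring
  have hqsmul : ∀ (c : ℝ) x, q₀ (c • x) = (c * c) • q₀ x := fun c x => by
    obtain ⟨A, B, D, l₁, l₂, hc⟩ := hplane x 0
    have e₁ := (hc c 0).1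
    have e₂ := (hc 1 0).1
    simp only [smul_zero, add_zero, one_smul] at e₁ e₂
    rw [e₁, e₂, smul_eq_mul]
    ring
  have hpar : ∀ x y, q₀ (x + y) + q₀ (x - y) = 2 * q₀ x + 2 * q₀ y := fun x y => by
    obtain ⟨A, B, D, l₁, l₂, hc⟩ := hplane x y
    have e₁ := (hc 1 0).1
    have e₂ := (hc 0 1).1
    have e₃ := (hc 1 1).1
    have e₄ := (hc 1 (-1)).1
    simp only [zero_smul, add_zero, zero_add, one_smul, neg_smul, ← sub_eq_add_neg] at e₁ e₂ e₃ e₄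
    rw [e₁, e₂, e₃, e₄]
    ring
  set l : E →ₗ[ℝ] ℝ := { toFun := l₀, map_add' := hladd, map_smul' := hlsmul } with hl
  set q : QuadraticForm ℝ E := QuadraticMap.ofPolar q₀ hqsmul
    (fun x x' y => by
      have e₁ := hpar (x + y) (x' + y)
      have e₂ := hpar x x'
      have e₃ := hpar (x + x' + y) y
      have e₄ : x + y + (x' + y) = x + x' + y + y := by abel
      have e₅ : x + y - (x' + y) = x - x' := by abel
      have e₆ : x + x' + y - y = x + x' := by abel
      rw [e₄, e₅] at e₁
      rw [e₆] at e₃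
      simp only [QuadraticMap.polar]
      linarith)
    (fun a x y => by
      obtain ⟨A, B, D, l₁, l₂, hc⟩ := hplane x y
      have e₁ := (hc a 0).1
      have e₂ := (hc 0 1).1
      have e₃ := (hc a 1).1
      have e₄ := (hc 1 0).1
      have e₅ := (hc 1 1).1
      simp only [zero_smul, add_zero, zero_add, one_smul] at e₁ e₂ e₃ e₄ e₅
      simp only [QuadraticMap.polar, smul_eq_mul]
      rw [e₁, e₂, e₃, e₄, e₅]
      ring) with hq
  have hqpos : q.PosDef := fun x hx => mul_pos (hpos x hx) (hpos _ (neg_ne_zero.2 hx))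
  obtain ⟨T, hT⟩ := exists_affineEquiv_image_closedBall hqpos l
  refine ⟨T, ?_⟩
  rw [← hT]
  ext x
  have hql : q x + l x = gauge K x * gauge K (-x) + (gauge K x - gauge K (-x)) := rfl
  rw [hmem, mem_ofPred_eq, hql]
  have := gauge_nonneg (s := K) (-x)
  constructor <;> intro hx <;> nlinarith

theorem exists_eval_ne_zero_of_isOpen {n : ℕ} {Q : MvPolynomial (Fin n) ℝ} (hQ : Q ≠ 0)
    {U : Set (EuclideanSpace ℝ (Fin n))} (hU : IsOpen U) (hne : U.Nonempty) :
    ∃ x ∈ U, MvPolynomial.eval (fun i => x i) Q ≠ 0 := by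
  obtain ⟨a, ha⟩ := hne
  have hV : IsOpen (WithLp.toLp 2 ⁻¹' U : Set (Fin n → ℝ)) :=
    hU.preimage (PiLp.continuous_toLp 2 _)
  obtain ⟨ε, hε, hball⟩ := Metric.isOpen_iff.1 hV (WithLp.ofLp a) ha
  by_contra! hcon
  refine hQ (MvPolynomial.funext_set (fun i => Metric.ball (a i) ε) (fun i => ?_) fun x hx => ?_)
  · exact infinite_of_mem_nhds (a i) (Metric.ball_mem_nhds _ hε)
  · rw [← ball_pi _ hε] at hx
    rw [map_zero]
    exact hcon _ (hball hx)

/-- The polynomial hypothesis on chord lengths, transported to a planar section of the body. -/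
theorem exists_polynomial_planar_chord {n : ℕ} {K : Set (EuclideanSpace ℝ (Fin n))} {m : ℕ}
    (hchord : ∀ p v ξ : EuclideanSpace ℝ (Fin n), ‖v‖ = 1 → ‖ξ‖ = 1 →
      (∃ s : ℝ, p + s • v ∈ interior K) →
      ∃ (P : Polynomial ℝ) (ε : ℝ), 0 < ε ∧
        ∀ t : ℝ, |t| < ε → (chordLenLine K p v ξ t) ^ m = P.eval t)
    {o u v : EuclideanSpace ℝ (Fin n)} (hu : u ≠ 0) (hv : v ≠ 0) {t₀ : ℝ}
    (hint : ∃ y : ℝ, o + t₀ • u + y • v ∈ interior K) :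
    ∃ P : ℝ[X], ∀ᶠ t in 𝓝 t₀,
      (volume {y : ℝ | o + t • u + y • v ∈ K}).toReal ^ m = P.eval t := by
  have hu0 := norm_ne_zero_iff.2 hu
  have hv0 := norm_ne_zero_iff.2 hv
  obtain ⟨y₀, hy₀⟩ := hint
  obtain ⟨P, ε, hε, hP⟩ := hchord (o + t₀ • u) (‖v‖⁻¹ • v) (‖u‖⁻¹ • u)
    (norm_smul_inv_norm hv) (norm_smul_inv_norm hu)
    ⟨y₀ * ‖v‖, by rwa [smul_smul, mul_assoc, mul_inv_cancel₀ hv0, mul_one]⟩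
  refine ⟨C ((‖v‖⁻¹) ^ m) * P.comp (C ‖u‖ * (X - C t₀)), ?_⟩
  have hnear : ∀ᶠ t in 𝓝 t₀, |‖u‖ * (t - t₀)| < ε := by
    have : Tendsto (fun t => |‖u‖ * (t - t₀)|) (𝓝 t₀) (𝓝 0) := by
      have hc : Continuous fun t => |‖u‖ * (t - t₀)| := by fun_prop
      simpa using hc.tendsto t₀
    exact this.eventually_lt_const hε
  filter_upwards [hnear] with t ht
  have hset : {y : ℝ | o + t • u + y • v ∈ K} = (fun y => ‖v‖ * y) ⁻¹'
      {s : ℝ | o + t₀ • u + s • ‖v‖⁻¹ • v + (‖u‖ * (t - t₀)) • ‖u‖⁻¹ • u ∈ K} := by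
    ext y
    have e₁ : (‖v‖ * y) • ‖v‖⁻¹ • v = y • v := by
      rw [smul_smul, mul_right_comm, mul_inv_cancel₀ hv0, one_mul]
    have e₂ : (‖u‖ * (t - t₀)) • ‖u‖⁻¹ • u = (t - t₀) • u := by
      rw [smul_smul, mul_right_comm, mul_inv_cancel₀ hu0, one_mul]
    have e₃ : o + t₀ • u + y • v + (t - t₀) • u = o + t • u + y • v := by module
    simp only [mem_ofPred_eq, mem_preimage, e₁, e₂, e₃]
  have hlen : (volume {y : ℝ | o + t • u + y • v ∈ K}).toReal =
      ‖v‖⁻¹ * chordLenLine K (o + t₀ • u) (‖v‖⁻¹ • v) (‖u‖⁻¹ • u) (‖u‖ * (t - t₀)) := by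
    rw [hset, Real.volume_preimage_mul_left hv0, ENNReal.toReal_mul,
      ENNReal.toReal_ofReal (abs_nonneg _), abs_of_nonneg (by positivity)]
    rfl
  rw [hlen, mul_pow, hP _ ht]
  simp

/-- Planar sections of the body through a point off the zero set are conic domains. -/
theorem exists_conic_planar_section {n : ℕ} {K : Set (EuclideanSpace ℝ (Fin n))}
    (hKcomp : IsCompact K) (hKconv : Convex ℝ K) {Q : MvPolynomial (Fin n) ℝ}
    (hQbd : ∀ x ∈ frontier K, MvPolynomial.eval (fun i => x i) Q = 0) {m : ℕ} (hm : 1 ≤ m)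
    (hchord : ∀ p v ξ : EuclideanSpace ℝ (Fin n), ‖v‖ = 1 → ‖ξ‖ = 1 →
      (∃ s : ℝ, p + s • v ∈ interior K) →
      ∃ (P : Polynomial ℝ) (ε : ℝ), 0 < ε ∧
        ∀ t : ℝ, |t| < ε → (chordLenLine K p v ξ t) ^ m = P.eval t)
    {o u w : EuclideanSpace ℝ (Fin n)} (ho : o ∈ interior K)
    (hQo : MvPolynomial.eval (fun i => o i) Q ≠ 0) (huw : LinearIndependent ℝ ![u, w]) :
    ∃ A B D l₁ l₂ : ℝ, ∀ x y : ℝ, o + (x • u + y • w) ∈ K ↔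
      A * x ^ 2 + B * (x * y) + D * y ^ 2 + (l₁ * x + l₂ * y) ≤ 1 := by
  set Φ : ℝ × ℝ →ₗ[ℝ] EuclideanSpace ℝ (Fin n) :=
    (LinearMap.toSpanSingleton ℝ _ u).coprod (LinearMap.toSpanSingleton ℝ _ w) with hΦ
  have hΦa : ∀ z, Φ z = z.1 • u + z.2 • w := fun z => by simp [hΦ]
  have hker : LinearMap.ker Φ = ⊥ := by
    refine LinearMap.ker_eq_bot'.2 fun z hz => ?_
    rw [hΦa] at hz
    exact Prod.ext_iff.2 (LinearIndependent.pair_iff.1 huw _ _ hz)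
  have hcont : Continuous fun z => o + Φ z :=
    continuous_const.add Φ.continuous_of_finiteDimensional
  set C : Set (ℝ × ℝ) := (fun z => o + Φ z) ⁻¹' K with hC
  have hCmem : ∀ z, z ∈ C ↔ o + (z.1 • u + z.2 • w) ∈ K := fun z => by
    rw [← hΦa]; rfl
  have hCcomp : IsCompact C :=
    ((Homeomorph.addLeft o).isClosedEmbedding.comp
      (LinearMap.isClosedEmbedding_of_injective hker)).isCompact_preimage hKcomp
  have hCconv : Convex ℝ C := (hKconv.translate_preimage_right o).linear_preimage Φ
  have h0 : (0 : ℝ × ℝ) ∈ interior C :=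
    preimage_interior_subset_interior_preimage hcont (by simpa using ho)
  set R : MvPolynomial (Fin 2) ℝ := MvPolynomial.bind₁ (fun i => MvPolynomial.C (o i) +
    (MvPolynomial.X 0 * MvPolynomial.C (u i) + MvPolynomial.X 1 * MvPolynomial.C (w i))) Q with hR
  have hReval : ∀ z : ℝ × ℝ, MvPolynomial.eval ![z.1, z.2] R =
      MvPolynomial.eval (fun i => (o + (z.1 • u + z.2 • w)) i) Q := fun z => by
    have := MvPolynomial.eval₂Hom_bind₁ (RingHom.id ℝ) ![z.1, z.2] (fun i => MvPolynomial.C (o i) +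
      (MvPolynomial.X 0 * MvPolynomial.C (u i) + MvPolynomial.X 1 * MvPolynomial.C (w i))) Q
    refine this.trans ?_
    change MvPolynomial.eval (fun i => MvPolynomial.eval ![z.1, z.2] (MvPolynomial.C (o i) +
      (MvPolynomial.X 0 * MvPolynomial.C (u i) + MvPolynomial.X 1 * MvPolynomial.C (w i)))) Q = _
    simp
  have hR0 : R ≠ 0 := fun h => hQo (by simpa [h, eq_comm] using hReval 0)
  obtain ⟨A, B, D, l₁, l₂, h⟩ := exists_conic_of_radical_polynomial_chords hCcomp hCconv h0 hR0
    (fun z hz => by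
      rw [hReval, ← hΦa]
      exact hQbd _ (hcont.frontier_preimage_subset K hz)) hm fun k t₀ ⟨r, hr, p, hp, hpt⟩ => by
        have hne : u ≠ 0 := huw.ne_zero 0
        have hne' : k • u + w ≠ 0 := fun h => by
          have := LinearIndependent.pair_iff.1 huw k 1 (by rwa [one_smul])
          exact one_ne_zero this.2
        obtain ⟨P, hP⟩ := exists_polynomial_planar_chord hchord (o := o) (t₀ := t₀) hne hne'
          ⟨r * p.2, by
            have := hKconv.combo_interior_self_mem_interior ho ((hCmem p).1 hp)
              (sub_pos.2 hr.2) hr.1 (by ring)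
            convert this using 1
            rw [hpt]
            module⟩
        refine ⟨P, hP.mono fun t ht => ?_⟩
        rw [← ht]
        have : {y : ℝ | (t + k * y, y) ∈ C} = {y : ℝ | o + t • u + y • (k • u + w) ∈ K} := by
          ext y
          have e : o + ((t + k * y) • u + y • w) = o + t • u + y • (k • u + w) := by module
          rw [mem_ofPred_eq, mem_ofPred_eq, hCmem, e]
        rw [this]
  exact ⟨A, B, D, l₁, l₂, fun x y => (hCmem (x, y)).symm.trans (h x y)⟩

/-- **Domains with radical-polynomial X-ray transform.**
If `K ⊂ ℝⁿ` (`n ≥ 2`) is a compact convex body with `C^∞` semi-algebraic boundary and for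
every affine line `L` meeting the interior of `K` and every unit vector `ξ` the `m`-th power
of the chord length function `t ↦ |K ∩ (L + t·ξ)|` is a polynomial in `t` near `t = 0`,
then `∂K` is an ellipsoid, i.e. `K` is the image of the closed unit ball under an
invertible affine map. -/
theorem radical_polynomial_xray_ellipsoid
    (n : ℕ) (hn : 2 ≤ n)
    (K : Set (EuclideanSpace ℝ (Fin n)))
    (hKcomp : IsCompact K) (hKconv : Convex ℝ K) (hKint : (interior K).Nonempty)
    (Q : MvPolynomial (Fin n) ℝ)
    (hQirr : Irreducible (MvPolynomial.map (algebraMap ℝ ℂ) Q))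
    (hQbd : ∀ x ∈ frontier K, MvPolynomial.eval (fun i => x i) Q = 0)
    (hQgrad : ∀ x ∈ frontier K,
      ∃ i : Fin n, MvPolynomial.eval (fun j => x j) (MvPolynomial.pderiv i Q) ≠ 0)
    (m : ℕ) (hm : 1 ≤ m)
    (hchord : ∀ p v ξ : EuclideanSpace ℝ (Fin n), ‖v‖ = 1 → ‖ξ‖ = 1 →
      (∃ s : ℝ, p + s • v ∈ interior K) →
      ∃ (P : Polynomial ℝ) (ε : ℝ), 0 < ε ∧
        ∀ t : ℝ, |t| < ε → (chordLenLine K p v ξ t) ^ m = P.eval t) :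
    ∃ T : EuclideanSpace ℝ (Fin n) ≃ᵃ[ℝ] EuclideanSpace ℝ (Fin n),
      K = T '' Metric.closedBall 0 1 := by
  have hQ0 : Q ≠ 0 := fun h => hQirr.ne_zero (by rw [h, map_zero])
  obtain ⟨o, ho, hQo⟩ := exists_eval_ne_zero_of_isOpen hQ0 isOpen_interior hKint
  obtain ⟨T, hT⟩ := exists_affineEquiv_image_closedBall_of_planar_sections
    ((Homeomorph.addLeft o).isClosedEmbedding.isCompact_preimage hKcomp)
    (hKconv.translate_preimage_right o)
    (preimage_interior_subset_interior_preimage (Homeomorph.addLeft o).continuous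
      (by simpa using ho))
    fun u w huw => exists_conic_planar_section hKcomp hKconv hQbd hm hchord ho hQo huw
  refine ⟨T.trans (AffineEquiv.constVAdd ℝ _ o), ?_⟩
  have hK : K = (fun x => o + x) '' ((fun x => o + x) ⁻¹' K) :=
    (image_preimage_eq K (Homeomorph.addLeft o).surjective).symm
  rw [hK]
  refine (congrArg (image fun x => o + x) hT).trans ?_
  rw [← image_comp]
  rfl
end

section
/- Let Q(x₁,x₂) be a real polynomial, irreducible over ℂ, let K ⊂ ℝ² be a compact convex body with C^∞ boundary Γ = ∂K satisfying Γ ⊆ Q⁻¹(0) and ∇Q ≠ 0 on Γ, and regard Q as a polynomial on ℂ². Then there is a finite set Z₀ ⊂ ℝ with the following property: whenever t₀ ∈ ℝ \ Z₀ is such that the horizontal line {x ∈ ℝ² : x₂ = t₀} intersects Γ transversally at exactly two points a = (a₁,t₀) and b = (b₁,t₀), there exist an open connected unbounded set U ⊆ ℂ containing t₀ and holomorphic functions f^a, f^b : U → ℂ such that: (i) Q(f^a(t), t) = 0 and Q(f^b(t), t) = 0 for all t ∈ U; (ii) for every t ∈ U ∩ ℝ the values f^a(t), f^b(t) are real and the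 points (f^a(t), t), (f^b(t), t) lie on Γ; (iii) f^a(t₀) = a₁ and f^b(t₀) = b₁. -/
open MeasureTheory

/-- The point `(a, b) ∈ ℝ²`. -/
noncomputable def mk2 (a b : ℝ) : EuclideanSpace ℝ (Fin 2) :=
  (WithLp.equiv 2 (Fin 2 → ℝ)).symm ![a, b]

/-- Evaluation of the complexification of a real polynomial `Q(x₁,x₂)` at `(z₁,z₂) ∈ ℂ²`. -/
noncomputable def evalC (Q : MvPolynomial (Fin 2) ℝ) (z1 z2 : ℂ) : ℂ :=
  MvPolynomial.eval ![z1, z2] (MvPolynomial.map (algebraMap ℝ ℂ) Q)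

open Polynomial Filter Topology Set

/-- An irreducible bivariate polynomial, viewed as a polynomial in its first variable. -/
theorem exists_irreducible_eval_map_eq {K : Type*} [Field K] (P : MvPolynomial (Fin 2) K)
    (hP : Irreducible P) :
    ∃ F : K[X][X], Irreducible F ∧
      ∀ z t : K, MvPolynomial.eval ![z, t] P = (F.map (evalRingHom t)).eval z := by
  let e := (MvPolynomial.finSuccEquiv K 1).trans
    (Polynomial.mapAlgEquiv (MvPolynomial.uniqueAlgEquiv K (Fin 1)))
  refine ⟨e P, (MulEquiv.irreducible_iff e).2 hP, fun z t ↦ ?_⟩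
  have : MvPolynomial.eval ![z, t] =
    ((evalRingHom z).comp (mapRingHom (evalRingHom t))).comp (e : _ →+* K[X][X]) := by
    ext i
    · simp [e, MvPolynomial.finSuccEquiv_apply]
    · fin_cases i
      · simp [e, MvPolynomial.finSuccEquiv_apply]
      · have h : MvPolynomial.finSuccEquiv K 1 (.X 1) = C (.X 0) :=
          MvPolynomial.finSuccEquiv_X_succ (j := 0)
        simp [e, h]
  simp [this]

/-- Away from the roots of some nonzero `r`, specializing the coefficients of an irreducible
`F ∈ K[X][Y]` preserves its degree and produces a polynomial with only simple roots. -/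
theorem exists_good_specializations {K : Type*} [Field K] [CharZero K] {F : K[X][X]}
    (hF : Irreducible F) :
    ∃ r : K[X], r ≠ 0 ∧ ∀ t, r.eval t ≠ 0 → F.leadingCoeff.eval t ≠ 0 ∧
      ∀ z, (F.map (evalRingHom t)).eval z = 0 → (F.map (evalRingHom t)).derivative.eval z ≠ 0 := by
  by_cases hd : F.natDegree = 0
  · refine ⟨F.leadingCoeff, by simpa using hF.ne_zero, fun t ht ↦ ⟨ht, fun z hz ↦ ?_⟩⟩
    rw [eq_C_of_natDegree_eq_zero hd] at hz ht
    simp_all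
  have hs : (F.map (algebraMap K[X] (FractionRing K[X]))).Separable :=
    ((hF.isPrimitive hd).irreducible_iff_irreducible_map_fraction_map.1 hF).separable
  have hinj := FaithfulSMul.algebraMap_injective K[X] (FractionRing K[X])
  have hr : resultant F (derivative F) ≠ 0 := by
    intro h
    have := congrArg (algebraMap K[X] (FractionRing K[X])) h
    rw [← resultant_map_map, ← natDegree_map_eq_of_injective hinj,
      ← natDegree_map_eq_of_injective hinj, ← derivative_map, map_zero,
      resultant_eq_zero_iff] at this
    exact this.2 hs
  obtain ⟨p, q, -, -, h⟩ := exists_mul_add_mul_eq_C_resultant F (derivative F) le_rfl le_rfl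
    (.inl hd)
  refine ⟨resultant F (derivative F) * F.leadingCoeff, mul_ne_zero hr (by simpa using hF.ne_zero),
    fun t ht ↦ ?_⟩
  rw [eval_mul] at ht
  refine ⟨right_ne_zero_of_mul ht, fun z hz hz' ↦ left_ne_zero_of_mul ht ?_⟩
  have := congrArg (fun G : K[X][X] ↦ (G.map (evalRingHom t)).eval z) h
  rw [derivative_map] at hz'
  simpa [hz, hz'] using this.symm

/-- The value of `F ∈ ℂ[X][Y]` at `X = p.1`, `Y = p.2`. -/
noncomputable def bivariateEval (F : ℂ[X][X]) (p : ℂ × ℂ) : ℂ :=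
  (F.map (evalRingHom p.1)).eval p.2

theorem bivariateEval_eq_sum (F : ℂ[X][X]) :
    bivariateEval F = fun p ↦
      ∑ i ∈ Finset.range (F.natDegree + 1), (F.coeff i).eval p.1 * p.2 ^ i := by
  ext p
  rw [bivariateEval, eval_eq_sum_range' (Nat.lt_succ_of_le natDegree_map_le)]
  simp

theorem contDiff_bivariateEval (F : ℂ[X][X]) {n : WithTop ℕ∞} : ContDiff ℂ n (bivariateEval F) := by
  rw [bivariateEval_eq_sum]
  refine ContDiff.sum fun i _ ↦ ?_
  have : ContDiff ℂ n fun x ↦ (F.coeff i).eval x := by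
    simpa only [coe_aeval_eq_eval] using (F.coeff i).contDiff_aeval (𝕜 := ℂ) n
  fun_prop

/-- Near a point where `∂F/∂Y ≠ 0`, the zero set of `F` is the graph of a function. -/
theorem exists_local_branch {F : ℂ[X][X]} {p : ℂ × ℂ} (h0 : bivariateEval F p = 0)
    (h1 : bivariateEval (derivative F) p ≠ 0) :
    ∃ ψ : ℂ → ℂ, DifferentiableAt ℂ ψ p.1 ∧ ψ p.1 = p.2 ∧
      ∀ᶠ v in 𝓝 p, bivariateEval F v = 0 ↔ ψ v.1 = v.2 := by
  have hs : HasStrictFDerivAt (bivariateEval F) (fderiv ℂ (bivariateEval F) p) p :=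
    (contDiff_bivariateEval F (n := 1)).contDiffAt.hasStrictFDerivAt one_ne_zero
  have hd : (fderiv ℂ (bivariateEval F) p) ∘SL ContinuousLinearMap.inr ℂ ℂ ℂ =
      ContinuousLinearMap.toSpanSingleton ℂ (bivariateEval (derivative F) p) := by
    have h2 : HasFDerivAt (fun z : ℂ ↦ (p.1, z)) (ContinuousLinearMap.inr ℂ ℂ ℂ) p.2 :=
      hasFDerivAt_prodMk_right p.1 p.2
    have h3 := HasFDerivAt.comp p.2 (hs.hasFDerivAt : HasFDerivAt _ _ (p.1, p.2)) h2
    have h4 := ((F.map (evalRingHom p.1)).hasDerivAt p.2).hasFDerivAt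
    rw [derivative_map] at h4
    exact h3.unique h4
  have hi : ((fderiv ℂ (bivariateEval F) p) ∘SL ContinuousLinearMap.inr ℂ ℂ ℂ).IsInvertible := by
    rw [hd]
    refine ⟨ContinuousLinearEquiv.unitsEquivAut ℂ (Units.mk0 _ h1), ?_⟩
    ext; simp
  have he := hs.eventually_apply_eq_iff_implicitFunctionOfProdDomain hi
  rw [h0] at he
  exact ⟨_, (hs.hasStrictFDerivAt_implicitFunctionOfProdDomain hi).hasFDerivAt.differentiableAt,
    he.self_of_nhds.1 h0, he⟩

/-- The roots of `F(t, ·)` are locally bounded where the leading coefficient does not vanish. -/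
theorem exists_root_bound {F : ℂ[X][X]} {t₀ : ℂ} (h : F.leadingCoeff.eval t₀ ≠ 0) :
    ∃ M : ℝ, ∀ᶠ t in 𝓝 t₀, ∀ z, bivariateEval F (t, z) = 0 → ‖z‖ ≤ M := by
  let b : ℂ → NNReal := fun t ↦ (Finset.range F.natDegree).sup (fun i ↦ ‖(F.coeff i).eval t‖₊) /
    ‖F.leadingCoeff.eval t‖₊ + 1
  have hb : ContinuousAt b t₀ := by
    refine ContinuousAt.add (ContinuousAt.div₀ ?_ ?_ (by simpa using h)) continuousAt_const
    · exact (Continuous.finset_sup_apply fun i _ ↦ (F.coeff i).continuous.nnnorm).continuousAt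
    · exact F.leadingCoeff.continuous.nnnorm.continuousAt
  refine ⟨b t₀ + 1, ?_⟩
  have h1 : ∀ᶠ t in 𝓝 t₀, b t < b t₀ + 1 := hb.eventually_lt_const (by simp)
  filter_upwards [h1, F.leadingCoeff.continuous.continuousAt.eventually_ne h] with t ht hl z hz
  have hne : F.map (evalRingHom t) ≠ 0 := fun h0 ↦ hl <| by
    simpa using congrArg (fun P ↦ P.coeff F.natDegree) h0
  have := IsRoot.norm_lt_cauchyBound hne hz
  have h2 : (F.map (evalRingHom t)).cauchyBound = b t := by
    have h3 := natDegree_map_of_leadingCoeff_ne_zero (evalRingHom t) hl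
    simp only [cauchyBound, leadingCoeff, h3, coeff_map, b, coe_evalRingHom]
  rw [h2] at this
  exact_mod_cast (this.trans ht).le

/-- The part of the zero set of `F` lying over `U`. -/
def rootCover (F : ℂ[X][X]) (U : Set ℂ) : Set (ℂ × ℂ) := {p | p.1 ∈ U ∧ bivariateEval F p = 0}

/-- The projection of `rootCover F U` to `U`. -/
def rootCoverProj (F : ℂ[X][X]) (U : Set ℂ) (p : rootCover F U) : U := ⟨p.1.1, p.2.1⟩

theorem continuous_rootCoverProj (F : ℂ[X][X]) (U : Set ℂ) : Continuous (rootCoverProj F U) :=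
  (continuous_fst.comp continuous_subtype_val).subtype_mk _

theorem isOpenMap_rootCoverProj {F : ℂ[X][X]} {U : Set ℂ}
    (hsep : ∀ p ∈ rootCover F U, bivariateEval (derivative F) p ≠ 0) :
    IsOpenMap (rootCoverProj F U) := by
  refine isOpenMap_iff_nhds_le.2 fun e N hN ↦ ?_
  obtain ⟨W, hW, hWN⟩ := (mem_nhds_subtype _ _ _).1 (mem_map.1 hN)
  obtain ⟨ψ, hψ, hψe, hiff⟩ := exists_local_branch e.2.2 (hsep e e.2)
  have hσ : Tendsto (fun t ↦ (t, ψ t)) (𝓝 e.1.1) (𝓝 e.1) := by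
    have : ContinuousAt (fun t ↦ (t, ψ t)) e.1.1 := continuousAt_id.prodMk hψ.continuousAt
    simpa [ContinuousAt, hψe] using this
  have hev := (hσ.eventually hiff).and (hσ.eventually hW)
  have hval : Tendsto ((↑) : U → ℂ) (𝓝 (rootCoverProj F U e)) (𝓝 e.1.1) :=
    continuous_subtype_val.continuousAt
  filter_upwards [hval.eventually hev] with t ht
  exact hWN (show (⟨(t, ψ t), t.2, ht.1.2 rfl⟩ : rootCover F U).1 ∈ W from ht.2)

theorem isLocalHomeomorph_rootCoverProj {F : ℂ[X][X]} {U : Set ℂ}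
    (hsep : ∀ p ∈ rootCover F U, bivariateEval (derivative F) p ≠ 0) :
    IsLocalHomeomorph (rootCoverProj F U) := by
  refine isLocalHomeomorph_iff_isOpenEmbedding_restrict.2 fun e ↦ ?_
  obtain ⟨ψ, -, -, hiff⟩ := exists_local_branch e.2.2 (hsep e e.2)
  obtain ⟨W, hWiff, hWo, heW⟩ := mem_nhds_iff.1 hiff
  have hWo' : IsOpen ((↑) ⁻¹' W : Set (rootCover F U)) := hWo.preimage continuous_subtype_val
  refine ⟨(↑) ⁻¹' W, hWo'.mem_nhds heW, .of_continuous_injective_isOpenMap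
    ((continuous_rootCoverProj F U).comp continuous_subtype_val) (fun a b hab ↦ ?_)
    ((isOpenMap_rootCoverProj hsep).comp hWo'.isOpenMap_subtype_val)⟩
  have h1 : a.1.1.1 = b.1.1.1 := congrArg Subtype.val hab
  have h2 := (hWiff a.2).1 a.1.2.2
  rw [h1, (hWiff b.2).1 b.1.2.2] at h2
  exact Subtype.ext (Subtype.ext (Prod.ext h1 h2.symm))

theorem isProperMap_rootCoverProj {F : ℂ[X][X]} {U : Set ℂ}
    (hlc : ∀ t ∈ U, F.leadingCoeff.eval t ≠ 0) : IsProperMap (rootCoverProj F U) := by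
  refine isProperMap_iff_ultrafilter.2 ⟨continuous_rootCoverProj F U, fun 𝒰 t ht ↦ ?_⟩
  obtain ⟨M, hM⟩ := exists_root_bound (hlc t t.2)
  have ht' : Tendsto (fun e : rootCover F U ↦ e.1.1) 𝒰 (𝓝 t.1) :=
    (continuous_subtype_val.tendsto t).comp ht
  have hball : Metric.closedBall (0 : ℂ) M ∈ (𝒰.map fun e ↦ e.1.2 : Ultrafilter ℂ) := by
    rw [Ultrafilter.mem_map]
    filter_upwards [ht'.eventually hM] with e he
    simpa using he e.1.2 e.2.2
  obtain ⟨z, -, hz⟩ := (isCompact_closedBall (0 : ℂ) M).ultrafilter_le_nhds' _ hball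
  have hp : Tendsto ((↑) : rootCover F U → ℂ × ℂ) 𝒰 (𝓝 (t.1, z)) := by
    rw [nhds_prod_eq]
    exact ht'.prodMk hz
  have hcont := (contDiff_bivariateEval F (n := 0)).continuous.tendsto (t.1, z)
  have h0 : bivariateEval F (t.1, z) = 0 := by
    refine tendsto_nhds_unique (hcont.comp hp) ?_
    exact tendsto_const_nhds.congr fun e ↦ e.2.2.symm
  exact ⟨⟨(t.1, z), t.2, h0⟩, rfl, by rw [nhds_subtype]; exact tendsto_iff_comap.1 hp⟩

theorem isCoveringMap_rootCoverProj {F : ℂ[X][X]} {U : Set ℂ}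
    (hlc : ∀ t ∈ U, F.leadingCoeff.eval t ≠ 0)
    (hsep : ∀ p ∈ rootCover F U, bivariateEval (derivative F) p ≠ 0) :
    IsCoveringMap (rootCoverProj F U) := by
  rw [isCoveringMap_iff_isCoveringMapOn_univ]
  refine (isProperMap_rootCoverProj hlc).isClosedMap.isCoveringMapOn_of_isLocalHomeomorphOn
    (fun t _ ↦ ?_) (isLocalHomeomorph_rootCoverProj hsep).isLocalHomeomorphOn
  have hne : F.map (evalRingHom t.1) ≠ 0 := fun h0 ↦ hlc t t.2 <| by
    simpa using congrArg (fun P ↦ P.coeff F.natDegree) h0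
  refine .of_injOn (f := fun e ↦ e.1.2) (t := {z | IsRoot (F.map (evalRingHom t.1)) z})
    (fun e he ↦ ?_) (fun e he e' he' h ↦ ?_) (finite_setOfPred_isRoot hne)
  · obtain rfl : rootCoverProj F U e = t := he
    exact e.2.2
  · have h1 : rootCoverProj F U e = rootCoverProj F U e' := Eq.trans he (Eq.symm he')
    exact Subtype.ext (Prod.ext (congrArg Subtype.val h1) h)

/-- Over a convex open set where `F(t, ·)` has constant degree and simple roots, every root extends
to a holomorphic branch. -/
theorem exists_holomorphic_branch {F : ℂ[X][X]} {U : Set ℂ} (hU : IsOpen U) (hconv : Convex ℝ U)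
    (hlc : ∀ t ∈ U, F.leadingCoeff.eval t ≠ 0)
    (hsep : ∀ p ∈ rootCover F U, bivariateEval (derivative F) p ≠ 0)
    {p : ℂ × ℂ} (hp : p ∈ rootCover F U) :
    ∃ f : ℂ → ℂ, DifferentiableOn ℂ f U ∧ (∀ t ∈ U, bivariateEval F (t, f t) = 0) ∧
      f p.1 = p.2 := by
  have := hconv.contractibleSpace ⟨p.1, hp.1⟩
  have := hU.locallyPathConnectedSpace
  obtain ⟨σ, ⟨hσp, hσ⟩, -⟩ :=
    (isCoveringMap_rootCoverProj hlc hsep).existsUnique_continuousMap_lifts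
      (.id U) ⟨p.1, hp.1⟩ ⟨p, hp⟩ rfl
  have hσ1 (t : U) : (σ t).1.1 = t := congrArg Subtype.val (congrFun hσ t)
  classical
  let f : ℂ → ℂ := fun t ↦ if ht : t ∈ U then (σ ⟨t, ht⟩).1.2 else 0
  have hf (t : U) : (σ t).1 = (t.1, f t) := Prod.ext (hσ1 t) (by simp [f])
  have hf0 : ∀ t ∈ U, bivariateEval F (t, f t) = 0 := fun t ht ↦ hf ⟨t, ht⟩ ▸ (σ ⟨t, ht⟩).2.2
  have hfc : ContinuousOn f U := by
    rw [continuousOn_iff_continuous_domRestrict]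
    exact (continuous_snd.comp (continuous_subtype_val.comp σ.continuous)).congr
      fun t ↦ by simp [hf]
  refine ⟨f, fun t ht ↦ ?_, hf0, by simpa [hσp] using (congrArg Prod.snd (hf ⟨p.1, hp.1⟩)).symm⟩
  obtain ⟨ψ, hψ, -, hiff⟩ := exists_local_branch (hf0 t ht) (hsep (t, f t) ⟨ht, hf0 t ht⟩)
  refine DifferentiableAt.differentiableWithinAt (hψ.congr_of_eventuallyEq ?_)
  have : ContinuousAt (fun s ↦ (s, f s)) t :=
    continuousAt_id.prodMk (hfc.continuousAt (hU.mem_nhds ht))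
  filter_upwards [this.eventually hiff, hU.mem_nhds ht] with s hs hsU
  exact (hs.1 (hf0 s hsU)).symm

theorem continuous_mk2 : Continuous fun p : ℝ × ℝ ↦ mk2 p.1 p.2 := by
  refine (PiLp.continuous_toLp 2 _).comp (continuous_pi fun i ↦ ?_)
  fin_cases i
  exacts [continuous_fst, continuous_snd]

theorem lineMap_mk2 (a b s r : ℝ) :
    AffineMap.lineMap (mk2 a s) (mk2 b s) r = mk2 (AffineMap.lineMap a b r) s := by
  ext i
  fin_cases i <;> simp [mk2, AffineMap.lineMap_apply]

/-- If a horizontal line meets the boundary of a convex body at exactly two points, then nearby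
horizontal lines meet the boundary near each of them. -/
theorem eventually_exists_mem_frontier_near {K : Set (EuclideanSpace ℝ (Fin 2))}
    (hKcl : IsClosed K) (hKconv : Convex ℝ K) {a b t₀ : ℝ} (hab : a ≠ b)
    (ha : mk2 a t₀ ∈ frontier K) (hb : mk2 b t₀ ∈ frontier K)
    (huniq : ∀ x ∈ frontier K, x 1 = t₀ → x 0 = a ∨ x 0 = b) {δ : ℝ} (hδ : 0 < δ) :
    ∀ᶠ s in 𝓝 t₀, ∃ c, |c - a| < δ ∧ mk2 c s ∈ frontier K := by
  have hint (x : ℝ) (hx : mk2 x t₀ ∈ K) (hxa : x ≠ a) (hxb : x ≠ b) : mk2 x t₀ ∈ interior K := by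
    by_contra h
    rcases huniq (mk2 x t₀) ⟨subset_closure hx, h⟩ rfl with h | h
    exacts [hxa h, hxb h]
  have hba : 0 < |b - a| := abs_pos.2 (sub_ne_zero.2 hab.symm)
  obtain ⟨r, hr0, hr⟩ := exists_between (lt_min one_pos (div_pos hδ hba))
  have hr1 := hr.trans_le (min_le_left _ _)
  have hrδ : r * |b - a| < δ := (lt_div_iff₀ hba).1 (hr.trans_le (min_le_right _ _))
  have hba' : b - a ≠ 0 := sub_ne_zero.2 hab.symm
  have hin : mk2 (a + r * (b - a)) t₀ ∈ interior K := by
    refine hint _ ?_ ?_ ?_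
    · have := hKconv.lineMap_mem (hKcl.frontier_subset ha) (hKcl.frontier_subset hb)
        ⟨hr0.le, hr1.le⟩
      rw [lineMap_mk2] at this
      convert! this using 2
      simp [AffineMap.lineMap_apply]; ring
    · simp [hr0.ne', hba']
    · intro h
      rcases mul_eq_zero.1 (show (b - a) * (1 - r) = 0 by linarith) with h | h
      · exact hba' h
      · linarith
  have hout : mk2 (a - r * (b - a)) t₀ ∉ K := by
    intro h
    have h1 : mk2 (a - r * (b - a)) t₀ ∈ interior K := by
      refine hint _ h ?_ ?_
      · simp [hr0.ne', hba']
      · intro h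
        rcases mul_eq_zero.1 (show (b - a) * (1 + r) = 0 by linarith) with h | h
        · exact hba' h
        · linarith
    refine ha.2 (hKconv.openSegment_interior_closure_subset_interior h1 hb.1 ?_)
    rw [openSegment_eq_image_lineMap]
    refine ⟨r / (1 + r), ⟨by positivity, (div_lt_one (by positivity)).2 (by linarith)⟩, ?_⟩
    rw [lineMap_mk2]
    congr 1
    simp only [AffineMap.lineMap_apply, vsub_eq_sub, vadd_eq_add, smul_eq_mul]
    field_simp
    ring
  have hcont (x : ℝ) : Continuous (mk2 x) :=
    continuous_mk2.comp (by fun_prop : Continuous fun s : ℝ ↦ (x, s))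
  filter_upwards [(hcont _).continuousAt.eventually (isOpen_interior.mem_nhds hin),
    (hcont _).continuousAt.eventually (hKcl.isOpen_compl.mem_nhds hout)] with s hs1 hs2
  have hpre : IsPreconnected ((fun x ↦ mk2 x s) '' Metric.closedBall a (r * |b - a|)) := by
    refine (convex_closedBall _ _).isPreconnected.image _ ?_
    exact (continuous_mk2.comp (by fun_prop : Continuous fun x : ℝ ↦ (x, s))).continuousOn
  by_contra! hne
  have hcover : (fun x ↦ mk2 x s) '' Metric.closedBall a (r * |b - a|) ⊆ interior K ∪ Kᶜ := by
    rintro _ ⟨x, hx, rfl⟩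
    by_contra h
    rw [mem_union, not_or, notMem_compl_iff] at h
    exact hne x ((mem_closedBall_iff_norm.1 hx).trans_lt hrδ) ⟨subset_closure h.2, h.1⟩
  obtain ⟨y, -, hy1, hy2⟩ := hpre _ _ isOpen_interior hKcl.isOpen_compl hcover
    ⟨_, ⟨_, by simp [abs_of_pos hr0], rfl⟩, hs1⟩
    ⟨_, ⟨_, by simp [abs_of_pos hr0], rfl⟩, hs2⟩
  exact hy2 (interior_subset hy1)

theorem evalC_ofReal (Q : MvPolynomial (Fin 2) ℝ) (a s : ℝ) :
    evalC Q a s = (MvPolynomial.eval ![a, s] Q : ℝ) := by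
  have h : ![(a : ℂ), s] = algebraMap ℝ ℂ ∘ ![a, s] := by
    ext i
    fin_cases i <;> rfl
  rw [evalC, h, MvPolynomial.eval_map, ← MvPolynomial.aeval_def,
    MvPolynomial.aeval_algebraMap_apply]
  simp

/-- A branch through a real simple root which is a limit of real zeros satisfying `P` is real and
satisfies `P` at nearby real parameters. -/
theorem eventually_branch_eq_ofReal {F : ℂ[X][X]} {f : ℂ → ℂ} {a t₀ : ℝ} {P : ℝ → ℝ → Prop}
    (hP : ∀ c s, P c s → bivariateEval F (s, c) = 0)
    (hnear : ∀ δ > 0, ∀ᶠ s in 𝓝 t₀, ∃ c, |c - a| < δ ∧ P c s)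
    (hfc : ContinuousAt f t₀) (hfa : f t₀ = a)
    (hf0 : ∀ᶠ t in 𝓝 (t₀ : ℂ), bivariateEval F (t, f t) = 0)
    (hsep : bivariateEval (derivative F) (t₀, a) ≠ 0) :
    ∀ᶠ s : ℝ in 𝓝 t₀, ∃ c : ℝ, f s = c ∧ P c s := by
  have h0 : bivariateEval F (t₀, a) = 0 := hfa ▸ hf0.self_of_nhds
  obtain ⟨ψ, -, -, hiff⟩ := exists_local_branch h0 hsep
  obtain ⟨δ, hδ, hball⟩ := Metric.eventually_nhds_iff_ball.1 hiff
  have hof : Tendsto ((↑) : ℝ → ℂ) (𝓝 t₀) (𝓝 (t₀ : ℂ)) := Complex.continuous_ofReal.continuousAt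
  have hgraph : Tendsto (fun t ↦ (t, f t)) (𝓝 (t₀ : ℂ)) (𝓝 ((t₀ : ℂ), (a : ℂ))) :=
    hfa ▸ continuousAt_id.prodMk hfc
  filter_upwards [hnear δ hδ, Metric.ball_mem_nhds t₀ hδ, hof.eventually hf0,
    hof.eventually (hgraph.eventually hiff)] with s ⟨c, hca, hc⟩ hs hfs hψ
  refine ⟨c, ?_, hc⟩
  rw [← hψ.1 hfs]
  refine (hball (s, c) ?_).1 (hP c s hc)
  rw [← ball_prod_same]
  exact ⟨by simpa [Complex.dist_of_im_eq, Real.dist_eq] using hs,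
    by simpa [Complex.dist_of_im_eq, Real.dist_eq] using hca⟩

/-- **Holomorphic continuation of the intersection points (Lemma 4.1).**
Let `Q` be a real polynomial, irreducible over `ℂ`, and `K ⊂ ℝ²` a compact convex body with
`C^∞` boundary `Γ ⊆ Q⁻¹(0)`, `∇Q ≠ 0` on `Γ`.  Then there is a finite set `Z₀ ⊂ ℝ` such
that whenever `t₀ ∉ Z₀` and the line `{x₂ = t₀}` meets `Γ` transversally at exactly two
points `a = (a₁,t₀)`, `b = (b₁,t₀)` (transversality: `∂Q/∂x₁ ≠ 0` there, i.e. the line is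
not tangent to the level curve `Γ`), there are an open connected unbounded set `U ∋ t₀` in
`ℂ` and holomorphic functions `f^a, f^b` on `U` with: (i) `Q(f^a(t),t) = Q(f^b(t),t) = 0`
on `U`; (ii) for real `t ∈ U` the values are real and `(f^a(t),t), (f^b(t),t) ∈ Γ`;
(iii) `f^a(t₀) = a₁`, `f^b(t₀) = b₁`. -/
theorem holomorphic_branches_of_chord_endpoints
    (Q : MvPolynomial (Fin 2) ℝ)
    (hQirr : Irreducible (MvPolynomial.map (algebraMap ℝ ℂ) Q))
    (K : Set (EuclideanSpace ℝ (Fin 2)))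
    (hKcomp : IsCompact K) (hKconv : Convex ℝ K) (hKint : (interior K).Nonempty)
    (hQbd : ∀ x ∈ frontier K, MvPolynomial.eval (fun i => x i) Q = 0)
    (hQgrad : ∀ x ∈ frontier K,
      ∃ i : Fin 2, MvPolynomial.eval (fun j => x j) (MvPolynomial.pderiv i Q) ≠ 0) :
    ∃ Z₀ : Set ℝ, Z₀.Finite ∧
      ∀ t₀ a₁ b₁ : ℝ, t₀ ∉ Z₀ → a₁ ≠ b₁ →
        mk2 a₁ t₀ ∈ frontier K → mk2 b₁ t₀ ∈ frontier K →
        (∀ x ∈ frontier K, x 1 = t₀ → x 0 = a₁ ∨ x 0 = b₁) →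
        MvPolynomial.eval ![a₁, t₀] (MvPolynomial.pderiv 0 Q) ≠ 0 →
        MvPolynomial.eval ![b₁, t₀] (MvPolynomial.pderiv 0 Q) ≠ 0 →
        ∃ (U : Set ℂ) (fa fb : ℂ → ℂ),
          IsOpen U ∧ IsConnected U ∧ ¬ Bornology.IsBounded U ∧ (t₀ : ℂ) ∈ U ∧
          DifferentiableOn ℂ fa U ∧ DifferentiableOn ℂ fb U ∧
          (∀ t ∈ U, evalC Q (fa t) t = 0 ∧ evalC Q (fb t) t = 0) ∧
          (∀ s : ℝ, (s : ℂ) ∈ U → (fa s).im = 0 ∧ (fb s).im = 0 ∧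
            mk2 (fa s).re s ∈ frontier K ∧ mk2 (fb s).re s ∈ frontier K) ∧
          fa t₀ = (a₁ : ℂ) ∧ fb t₀ = (b₁ : ℂ) := by
  have hKcl := hKcomp.isClosed
  obtain ⟨F, hF, hFQ⟩ := exists_irreducible_eval_map_eq _ hQirr
  obtain ⟨r, hr0, hr⟩ := exists_good_specializations hF
  have hQF (z t : ℂ) : evalC Q z t = bivariateEval F (t, z) := hFQ z t
  have hfr (c s : ℝ) (h : mk2 c s ∈ frontier K) : bivariateEval F (s, c) = 0 := by
    rw [← hQF, evalC_ofReal]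
    have h1 := hQbd _ h
    have h2 : (fun i ↦ mk2 c s i) = ![c, s] := rfl
    rw [h2] at h1
    simp [h1]
  have hfin : (Complex.re '' {t | r.IsRoot t}).Finite := (finite_setOfPred_isRoot hr0).image _
  refine ⟨_, hfin, fun t₀ a₁ b₁ ht₀ hab ha hb huniq _ _ ↦ ?_⟩
  let S : ℝ → Set ℂ := fun ε ↦ Complex.re ⁻¹' Metric.ball t₀ ε
  have hSo (ε : ℝ) : IsOpen (S ε) := Metric.isOpen_ball.preimage Complex.continuous_re
  have hSc (ε : ℝ) : Convex ℝ (S ε) := (convex_ball t₀ ε).linear_preimage Complex.reLm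
  have hSt {ε : ℝ} (hε : 0 < ε) : (t₀ : ℂ) ∈ S ε := by simpa [S] using hε
  obtain ⟨ε, hε, hεZ⟩ := Metric.mem_nhds_iff.1 (hfin.isClosed.isOpen_compl.mem_nhds ht₀)
  have hrS (t : ℂ) (ht : t ∈ S ε) : r.eval t ≠ 0 := fun h ↦ hεZ ht ⟨t, h, rfl⟩
  have hsep (p : ℂ × ℂ) (hp : p ∈ rootCover F (S ε)) : bivariateEval (derivative F) p ≠ 0 := by
    rw [bivariateEval, ← derivative_map]
    exact (hr p.1 (hrS p.1 hp.1)).2 p.2 hp.2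
  have key (a b : ℝ) (hab : a ≠ b) (ha : mk2 a t₀ ∈ frontier K) (hb : mk2 b t₀ ∈ frontier K)
      (huniq : ∀ x ∈ frontier K, x 1 = t₀ → x 0 = a ∨ x 0 = b) :
      ∃ f : ℂ → ℂ, DifferentiableOn ℂ f (S ε) ∧ (∀ t ∈ S ε, bivariateEval F (t, f t) = 0) ∧
        f t₀ = a ∧ ∀ᶠ s : ℝ in 𝓝 t₀, ∃ c : ℝ, f s = c ∧ mk2 c s ∈ frontier K := by
    have hp : ((t₀ : ℂ), (a : ℂ)) ∈ rootCover F (S ε) := ⟨hSt hε, hfr _ _ ha⟩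
    obtain ⟨f, hfd, hf0, hfa⟩ := exists_holomorphic_branch (hSo ε) (hSc ε)
      (fun t ht ↦ (hr t (hrS t ht)).1) hsep hp
    have hnhds := (hSo ε).mem_nhds (hSt hε)
    exact ⟨f, hfd, hf0, hfa, eventually_branch_eq_ofReal hfr
      (fun δ hδ ↦ eventually_exists_mem_frontier_near hKcl hKconv hab ha hb huniq hδ)
      (hfd.continuousOn.continuousAt hnhds) hfa (eventually_of_mem hnhds hf0) (hsep _ hp)⟩
  obtain ⟨fa, hda, hfa0, hfa, hfaK⟩ := key a₁ b₁ hab ha hb huniq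
  obtain ⟨fb, hdb, hfb0, hfb, hfbK⟩ := key b₁ a₁ hab.symm hb ha fun x hx h ↦ (huniq x hx h).symm
  obtain ⟨η, hη, hηK⟩ := Metric.eventually_nhds_iff_ball.1 (hfaK.and hfbK)
  have hpos := lt_min hε hη
  have hsub : S (min ε η) ⊆ S ε := preimage_mono (Metric.ball_subset_ball (min_le_left _ _))
  refine ⟨S (min ε η), fa, fb, hSo _, ⟨⟨t₀, hSt hpos⟩, (hSc _).isPreconnected⟩, fun hbd ↦ ?_,
    hSt hpos, hda.mono hsub, hdb.mono hsub, fun t ht ↦ ?_, fun s hs ↦ ?_, hfa, hfb⟩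
  · obtain ⟨M, hM⟩ := hbd.exists_norm_le
    have h1 := hM (⟨t₀, |M| + 1⟩ : ℂ) (by simpa [S] using hpos)
    have h2 := (Complex.abs_im_le_norm _).trans h1
    have h3 := (le_abs_self _).trans h2
    have h4 := le_abs_self M
    dsimp only at h3
    linarith
  · rw [hQF, hQF]
    exact ⟨hfa0 t (hsub ht), hfb0 t (hsub ht)⟩
  · obtain ⟨⟨c, hc, hcK⟩, ⟨d, hd, hdK⟩⟩ :=
      hηK s (Metric.ball_subset_ball (min_le_right ε η) hs)
    simp [hc, hd, hcK, hdK]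
end
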